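/- arXiv:math/0702192 — 2 statements merged into one kernel-verified Lean document; each statement's English description precedes it below -/
import Mathlib

section
/- Suppose θ has the NOF property. Let u,v ∈ ι(θ) with u ≤ v, suppose the interval [u,v] of Br(ι(θ)) is full, and let s ∈ S with s ∉ D_R(v) ∪ D_R(u). Then either u·s̲ = us (i.e., θ(s)us = u), or the interval [u, v·s̲] of Br(ι(θ)) is full (in particular v·s̲ ∈ ι(θ)). -/
namespace TwistedIdentitiesPaper

open scoped Classical

variable {B : Type*} {W : Type*} [Group W] {M : CoxeterMatrix B}

/-- The Bruhat order on `W`, defined via the subword property: `u ≤ v` iff every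
reduced expression for `v` contains a subword representing `u`. -/
def bruhatLE (cs : CoxeterSystem M W) (u v : W) : Prop :=
  ∀ l : List B, cs.IsReduced l → cs.wordProd l = v →
    ∃ l' : List B, l'.Sublist l ∧ cs.wordProd l' = u

/-- The strict Bruhat order. -/
def bruhatLT (cs : CoxeterSystem M W) (u v : W) : Prop :=
  bruhatLE cs u v ∧ u ≠ v

/-- The action `w ↦ w ⋅ s̲ᵢ`: `w ⋅ s̲ᵢ = w sᵢ` if `θ(sᵢ) w sᵢ = w`, and
`w ⋅ s̲ᵢ = θ(sᵢ) w sᵢ` otherwise. -/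
noncomputable def twistAct (cs : CoxeterSystem M W) (θ : W ≃* W) (w : W) (i : B) : W :=
  if θ (cs.simple i) * w * cs.simple i = w then w * cs.simple i
  else θ (cs.simple i) * w * cs.simple i

/-- `e ⋅ s̲₁ ⋯ s̲ₖ` for a word `s₁ ⋯ sₖ`. -/
noncomputable def twistProd (cs : CoxeterSystem M W) (θ : W ≃* W) (l : List B) : W :=
  l.foldl (twistAct cs θ) 1

/-- The set of twisted involutions `I(θ) = {w : θ(w) = w⁻¹}`. -/
def twistedInvolutions (θ : W ≃* W) : Set W := {w | θ w = w⁻¹}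

/-- The set of twisted identities `ι(θ) = {θ(w⁻¹) w : w ∈ W}`. -/
def twistedIdentities (θ : W ≃* W) : Set W := {w | ∃ v : W, w = θ v⁻¹ * v}

/-- The rank `ρ(w)` of a twisted involution: the least `k` such that
`w = e ⋅ s̲₁ ⋯ s̲ₖ`. -/
noncomputable def twistRank (cs : CoxeterSystem M W) (θ : W ≃* W) (w : W) : ℕ :=
  sInf {k | ∃ l : List B, l.length = k ∧ twistProd cs θ l = w}

/-- `θ` has the no-odd-flip (NOF) property: for every `s ∈ S` with `θ(s) ≠ s`,
the order of `s θ(s)` is even or infinite. -/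
def NOF (cs : CoxeterSystem M W) (θ : W ≃* W) : Prop :=
  ∀ i : B, θ (cs.simple i) ≠ cs.simple i →
    Even (orderOf (cs.simple i * θ (cs.simple i))) ∨
      orderOf (cs.simple i * θ (cs.simple i)) = 0


/-- The interval `[u,v]` of `Br(ι(θ))` is full if it contains no twisted involution
which is not a twisted identity. -/
def IsFull (cs : CoxeterSystem M W) (θ : W ≃* W) (u v : W) : Prop :=
  ∀ w : W, w ∈ twistedInvolutions θ → bruhatLE cs u w → bruhatLE cs w v →
    w ∈ twistedIdentities θ

section ReflectionCocycle

variable (cs : CoxeterSystem M W)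

/-- The action of a simple reflection on signed elements of `W`: conjugation, with a sign change
exactly at the reflection itself. -/
noncomputable def signedConj (i : B) : Function.End (W × ZMod 2) :=
  fun p => (cs.simple i * p.1 * cs.simple i, p.2 + if p.1 = cs.simple i then 1 else 0)

theorem simple_mul_mul_simple_eq_iff (i : B) (t x : W) :
    cs.simple i * t * cs.simple i = x ↔ t = cs.simple i * x * cs.simple i := by
  constructor
  · rintro rfl
    simp [mul_assoc]
  · rintro rfl
    simp [mul_assoc]

theorem signedConj_mul_pow_apply (i j : B) (n : ℕ) (t : W) (e : ZMod 2) :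
    ((signedConj cs i * signedConj cs j) ^ n) (t, e) =
      ((cs.simple i * cs.simple j) ^ n * t * ((cs.simple i * cs.simple j) ^ n)⁻¹,
        e + ∑ k ∈ Finset.range (2 * n),
          if t = cs.simple j * (cs.simple i * cs.simple j) ^ k then 1 else 0) := by
  induction n with
  | zero =>
    simp
    rfl
  | succ n ih =>
    have hconj : ∀ x : W, (cs.simple i * cs.simple j) ^ n * t *
        ((cs.simple i * cs.simple j) ^ n)⁻¹ = x ↔
        t = ((cs.simple i * cs.simple j) ^ n)⁻¹ * x * (cs.simple i * cs.simple j) ^ n := by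
      intro x
      constructor
      · rintro rfl
        group
      · rintro rfl
        group
    have hinv : ∀ k : ℕ, ((cs.simple i * cs.simple j) ^ k)⁻¹ * cs.simple j =
        cs.simple j * (cs.simple i * cs.simple j) ^ k := by
      intro k
      induction k with
      | zero => simp
      | succ k ihk =>
        rw [pow_succ, mul_inv_rev, mul_assoc, ihk, ← pow_succ, pow_succ']
        simp [mul_assoc]
    rw [pow_succ']
    change (signedConj cs i) ((signedConj cs j) (((signedConj cs i * signedConj cs j) ^ n) (t, e)))
      = _
    rw [ih]
    simp only [signedConj]
    rw [Prod.mk.injEq]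
    constructor
    · rw [pow_succ']
      simp [mul_assoc]
    · rw [show 2 * (n + 1) = 2 * n + 1 + 1 by ring, Finset.sum_range_succ, Finset.sum_range_succ]
      simp only [simple_mul_mul_simple_eq_iff, hconj, hinv]
      have h1 : cs.simple j * (cs.simple i * cs.simple j) ^ n * (cs.simple i * cs.simple j) ^ n =
          cs.simple j * (cs.simple i * cs.simple j) ^ (2 * n) := by
        rw [mul_assoc, ← pow_add, two_mul]
      have h2 : ((cs.simple i * cs.simple j) ^ n)⁻¹ * (cs.simple j * cs.simple i * cs.simple j) *
          (cs.simple i * cs.simple j) ^ n =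
          cs.simple j * (cs.simple i * cs.simple j) ^ (2 * n + 1) := by
        rw [mul_assoc (cs.simple j), ← mul_assoc, hinv, pow_succ, two_mul, pow_add]
        simp only [mul_assoc]
        congr 2
        rw [← mul_assoc (cs.simple i), ← pow_succ', pow_succ]
      rw [h1, h2]
      ring

theorem isLiftable_signedConj : M.IsLiftable (signedConj cs) := by
  intro i j
  funext ⟨t, e⟩
  rw [signedConj_mul_pow_apply, two_mul, Finset.sum_range_add]
  simp only [pow_add, cs.simple_mul_simple_pow, one_mul, inv_one, mul_one]
  rw [CharTwo.add_self_eq_zero, add_zero]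
  rfl

/-- The representation of `W` by signed conjugation. -/
noncomputable def signedConjRep : W →* Function.End (W × ZMod 2) :=
  cs.lift ⟨signedConj cs, isLiftable_signedConj cs⟩

/-- The reflection cocycle: for a reflection `t` it is `1` if `ℓ (w * t) < ℓ w` and `0`
otherwise. -/
noncomputable def reflCocycle (w t : W) : ZMod 2 := (signedConjRep cs w (t, 0)).2

theorem signedConjRep_simple (i : B) : signedConjRep cs (cs.simple i) = signedConj cs i :=
  cs.lift_apply_simple _ i

theorem signedConjRep_apply (w t : W) (e : ZMod 2) :
    signedConjRep cs w (t, e) = (w * t * w⁻¹, e + reflCocycle cs w t) := by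
  have key : ∀ (t : W) (e : ZMod 2), (signedConjRep cs w (t, e)).1 = w * t * w⁻¹ ∧
      (signedConjRep cs w (t, e)).2 = e + (signedConjRep cs w (t, 0)).2 := by
    induction w using cs.simple_induction_left with
    | one => intro t e; simp [Function.End.one_def]
    | mul_simple_left w i ih =>
      intro t e
      rw [map_mul, signedConjRep_simple]
      change (signedConj cs i (signedConjRep cs w (t, e))).1 = _ ∧
        (signedConj cs i (signedConjRep cs w (t, e))).2 =
          e + (signedConj cs i (signedConjRep cs w (t, 0))).2
      simp only [signedConj]
      rw [(ih t e).1, (ih t e).2, (ih t 0).1]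
      constructor
      · simp [mul_assoc]
      · ring
  exact Prod.ext (key t e).1 (key t e).2

theorem reflCocycle_mul (x y t : W) :
    reflCocycle cs (x * y) t = reflCocycle cs y t + reflCocycle cs x (y * t * y⁻¹) := by
  rw [reflCocycle, map_mul]
  change (signedConjRep cs x (signedConjRep cs y (t, 0))).2 = _
  rw [signedConjRep_apply, signedConjRep_apply]
  simp

@[simp]
theorem reflCocycle_one (t : W) : reflCocycle cs 1 t = 0 := by
  simp [reflCocycle, Function.End.one_def]

theorem reflCocycle_simple (i : B) (t : W) :
    reflCocycle cs (cs.simple i) t = if t = cs.simple i then 1 else 0 := by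
  simp [reflCocycle, signedConjRep_simple, signedConj]

theorem reflCocycle_wordProd_eq_zero {l : List B} {t : W} (h : t ∉ cs.rightInvSeq l) :
    reflCocycle cs (cs.wordProd l) t = 0 := by
  induction l with
  | nil => simp
  | cons i l ih =>
    simp only [CoxeterSystem.rightInvSeq, List.mem_cons, not_or] at h
    rw [cs.wordProd_cons, reflCocycle_mul, ih h.2, reflCocycle_simple, if_neg, add_zero]
    intro h'
    apply h.1
    rw [← h']
    group

theorem reflCocycle_inv_conj (x t : W) :
    reflCocycle cs x⁻¹ (x * t * x⁻¹) = reflCocycle cs x t := by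
  have h := reflCocycle_mul cs x⁻¹ x t
  rw [inv_mul_cancel, reflCocycle_one] at h
  exact (CharTwo.add_eq_zero.mp h.symm).symm

theorem reflCocycle_self {t : W} (ht : cs.IsReflection t) : reflCocycle cs t t = 1 := by
  obtain ⟨x, i, rfl⟩ := ht
  have h := reflCocycle_inv_conj cs x (cs.simple i)
  rw [reflCocycle_mul, reflCocycle_mul, h]
  simp only [inv_inv, mul_assoc, inv_mul_cancel, mul_one, inv_mul_cancel_left]
  simp only [← mul_assoc, reflCocycle_simple]
  simp only [CoxeterSystem.simple_mul_simple_self, cs.inv_simple, if_true]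
  rw [one_mul, add_left_comm, CharTwo.add_self_eq_zero, add_zero]

theorem zmod_two_eq_zero_or_one (x : ZMod 2) : x = 0 ∨ x = 1 := by
  revert x
  decide

theorem length_mul_lt_of_reflCocycle {w t : W} (h : reflCocycle cs w t = 1) :
    cs.length (w * t) < cs.length w := by
  obtain ⟨l, hl, rfl⟩ := cs.exists_isReduced w
  have hmem : t ∈ cs.rightInvSeq l := by
    by_contra hn
    rw [reflCocycle_wordProd_eq_zero cs hn] at h
    exact zero_ne_one h
  exact (cs.isRightInversion_of_mem_rightInvSeq hl hmem).2

theorem reflCocycle_eq_one_iff {t : W} (ht : cs.IsReflection t) (w : W) :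
    reflCocycle cs w t = 1 ↔ cs.length (w * t) < cs.length w := by
  refine ⟨length_mul_lt_of_reflCocycle cs, fun h => ?_⟩
  rcases zmod_two_eq_zero_or_one (reflCocycle cs w t) with h0 | h1
  · exfalso
    have h2 : reflCocycle cs (w * t) t = 1 := by
      rw [reflCocycle_mul, reflCocycle_self cs ht, mul_inv_cancel_right, h0, add_zero]
    have h3 := length_mul_lt_of_reflCocycle cs h2
    rw [mul_assoc, ht.mul_self, mul_one] at h3
    omega
  · exact h1

theorem reflCocycle_eq_zero_iff {t : W} (ht : cs.IsReflection t) (w : W) :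
    reflCocycle cs w t = 0 ↔ cs.length w < cs.length (w * t) := by
  have h1 := reflCocycle_eq_one_iff cs ht w
  have h2 := ht.length_mul_left_ne w
  rcases zmod_two_eq_zero_or_one (reflCocycle cs w t) with h | h
  · simp only [h, zero_ne_one, false_iff, true_iff] at h1 ⊢
    omega
  · simp only [h, one_ne_zero, true_iff, false_iff] at h1 ⊢
    omega

theorem reflCocycle_simple_eq_one_iff (w : W) (i : B) :
    reflCocycle cs w (cs.simple i) = 1 ↔ cs.IsRightDescent w i :=
  reflCocycle_eq_one_iff cs (cs.isReflection_simple i) w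

theorem reflCocycle_simple_eq_zero_iff (w : W) (i : B) :
    reflCocycle cs w (cs.simple i) = 0 ↔ ¬ cs.IsRightDescent w i := by
  rw [← reflCocycle_simple_eq_one_iff]
  rcases zmod_two_eq_zero_or_one (reflCocycle cs w (cs.simple i)) with h | h <;> simp [h]

theorem mem_rightInvSeq_of_length_lt {l : List B} {t : W} (ht : cs.IsReflection t)
    (h : cs.length (cs.wordProd l * t) < cs.length (cs.wordProd l)) :
    t ∈ cs.rightInvSeq l := by
  by_contra hn
  rw [← reflCocycle_eq_one_iff cs ht, reflCocycle_wordProd_eq_zero cs hn] at h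
  exact zero_ne_one h

/-- The strong exchange property. -/
theorem strong_exchange {l : List B} {t : W} (ht : cs.IsReflection t)
    (h : cs.length (cs.wordProd l * t) < cs.length (cs.wordProd l)) :
    ∃ j < l.length, cs.wordProd l * t = cs.wordProd (l.eraseIdx j) := by
  obtain ⟨j, hj, rfl⟩ := List.getElem_of_mem (mem_rightInvSeq_of_length_lt cs ht h)
  rw [cs.length_rightInvSeq] at hj
  refine ⟨j, hj, ?_⟩
  rw [← cs.wordProd_mul_getD_rightInvSeq, List.getD_eq_getElem]

/-- A reflection inverts no other element commuting with it. -/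
theorem reflCocycle_eq_zero_of_commute {q p : W} (hq : cs.IsReflection q)
    (hqp : q * p = p * q) (hne : p ≠ q) : reflCocycle cs q p = 0 := by
  obtain ⟨x, i, rfl⟩ := hq
  have h := reflCocycle_inv_conj cs x (x⁻¹ * p * x)
  have hc : cs.simple i * (x⁻¹ * p * x) * (cs.simple i)⁻¹ = x⁻¹ * p * x := by
    have := congrArg (fun z => x⁻¹ * z * x) hqp
    simp only [mul_assoc, inv_mul_cancel, inv_mul_cancel_left, mul_one] at this
    rw [mul_inv_eq_iff_eq_mul]
    simpa [mul_assoc] using this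
  have hx : x * (x⁻¹ * p * x) * x⁻¹ = p := by group
  rw [hx] at h
  rw [reflCocycle_mul, reflCocycle_mul, inv_inv, h, reflCocycle_simple, if_neg]
  · rw [hc, zero_add, CharTwo.add_self_eq_zero]
  · intro h'
    apply hne
    rw [← h']
    group

end ReflectionCocycle

section Bruhat

variable (cs : CoxeterSystem M W)

/-- The relation `a → b` whose reflexive transitive closure is the Bruhat order. -/
def BruhatStep (a b : W) : Prop :=
  ∃ t, cs.IsReflection t ∧ b = a * t ∧ cs.length a < cs.length b

open Relation in
theorem exists_sublist_of_bruhatStep {u v : W} (h : ReflTransGen (BruhatStep cs) u v)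
    {l : List B} (hl : cs.wordProd l = v) :
    ∃ l' : List B, l'.Sublist l ∧ cs.wordProd l' = u := by
  induction h using ReflTransGen.head_induction_on with
  | refl => exact ⟨l, List.Sublist.refl l, hl⟩
  | @head a _ hac _ ih =>
    obtain ⟨l', hl', rfl⟩ := ih
    obtain ⟨t, ht, hc, hlt⟩ := hac
    have ha : cs.wordProd l' * t = a := by rw [hc, mul_assoc, ht.mul_self, mul_one]
    rw [← ha] at hlt
    obtain ⟨j, -, hj⟩ := strong_exchange cs ht hlt
    exact ⟨l'.eraseIdx j, (l'.eraseIdx_sublist j).trans hl', by rw [← hj, ha]⟩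

theorem BruhatStep.mul_simple {a b : W} (h : BruhatStep cs a b) (i : B) :
    b = a * cs.simple i ∨ BruhatStep cs (a * cs.simple i) (b * cs.simple i) := by
  obtain ⟨t, ht, rfl, hlt⟩ := h
  rcases eq_or_ne t (cs.simple i) with rfl | hne
  · exact Or.inl rfl
  · right
    have hr : cs.IsReflection (cs.simple i * t * cs.simple i) := by
      simpa using ht.conj (cs.simple i)
    have he : a * t * cs.simple i = a * cs.simple i * (cs.simple i * t * cs.simple i) := by
      simp [mul_assoc]
    refine ⟨_, hr, he, ?_⟩
    rw [he, ← reflCocycle_eq_zero_iff cs hr, reflCocycle_mul, reflCocycle_simple, if_neg]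
    · simpa [mul_assoc] using (reflCocycle_eq_zero_iff cs ht a).mpr hlt
    · rw [simple_mul_mul_simple_eq_iff]
      simpa using hne

theorem bruhatStep_mul_simple {w : W} {i : B} (h : ¬ cs.IsRightDescent w i) :
    BruhatStep cs w (w * cs.simple i) :=
  ⟨_, cs.isReflection_simple i, rfl, by
    rwa [← reflCocycle_eq_zero_iff cs (cs.isReflection_simple i), reflCocycle_simple_eq_zero_iff]⟩

open Relation in
theorem bruhatStep_mul_simple_left {x y : W} (h : ReflTransGen (BruhatStep cs) x y) (i : B) :
    ReflTransGen (BruhatStep cs) (x * cs.simple i) y ∨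
      ReflTransGen (BruhatStep cs) (x * cs.simple i) (y * cs.simple i) := by
  induction h using ReflTransGen.head_induction_on with
  | refl => exact Or.inr .refl
  | head hac hcy ih =>
    rcases BruhatStep.mul_simple cs hac i with rfl | h
    · exact Or.inl hcy
    · exact ih.imp (.head h) (.head h)

open Relation in
theorem bruhatStep_mul_simple_right {x y : W} (h : ReflTransGen (BruhatStep cs) x y) (i : B) :
    ReflTransGen (BruhatStep cs) x (y * cs.simple i) ∨
      ReflTransGen (BruhatStep cs) (x * cs.simple i) (y * cs.simple i) := by
  induction h with
  | refl => exact Or.inr .refl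
  | tail hxc hcy ih =>
    rcases BruhatStep.mul_simple cs hcy i with rfl | h
    · left
      simpa using hxc
    · exact ih.imp (.tail · h) (.tail · h)

open Relation in
theorem bruhatStep_of_sublist {l l' : List B} (hl : cs.IsReduced l) (h : l'.Sublist l) :
    ReflTransGen (BruhatStep cs) (cs.wordProd l') (cs.wordProd l) := by
  induction l using List.reverseRecOn generalizing l' with
  | nil =>
    rw [List.sublist_nil.mp h]
  | append_singleton l i ih =>
    have hl0 : cs.IsReduced l := by simpa using hl.take l.length
    have hstep : BruhatStep cs (cs.wordProd l) (cs.wordProd (l ++ [i])) := by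
      refine ⟨_, cs.isReflection_simple i, by simp [cs.wordProd_append], ?_⟩
      rw [hl, hl0]
      simp
    obtain ⟨l₁, l₂, rfl, h₁, h₂⟩ := List.sublist_append_iff.mp h
    rcases List.sublist_singleton.mp h₂ with rfl | rfl
    · rw [List.append_nil]
      exact (ih hl0 h₁).tail hstep
    · have h' := bruhatStep_mul_simple_left cs (ih hl0 h₁) i
      simp only [cs.wordProd_append, cs.wordProd_singleton] at hstep ⊢
      exact h'.elim (.tail · hstep) id

theorem bruhatLE_iff {u v : W} :
    bruhatLE cs u v ↔ Relation.ReflTransGen (BruhatStep cs) u v := by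
  constructor
  · intro h
    obtain ⟨l, hl, rfl⟩ := cs.exists_isReduced v
    obtain ⟨l', hl', rfl⟩ := h l hl rfl
    exact bruhatStep_of_sublist cs hl hl'
  · intro h l _ hl
    exact exists_sublist_of_bruhatStep cs h hl

theorem bruhatLE_refl (w : W) : bruhatLE cs w w :=
  (bruhatLE_iff cs).mpr .refl

theorem bruhatLE.trans {cs : CoxeterSystem M W} {u v w : W} (huv : bruhatLE cs u v)
    (hvw : bruhatLE cs v w) : bruhatLE cs u w := by
  rw [bruhatLE_iff] at *
  exact Relation.ReflTransGen.trans huv hvw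

theorem bruhatLE.inv {cs : CoxeterSystem M W} {u v : W} (h : bruhatLE cs u v) :
    bruhatLE cs u⁻¹ v⁻¹ := by
  intro l hl hlv
  obtain ⟨l', hl', hu⟩ := h l.reverse (by simpa using hl) (by simp [hlv])
  exact ⟨l'.reverse, by simpa using hl'.reverse, by simp [hu]⟩

theorem bruhatLE_mul_simple {w : W} {i : B} (h : ¬ cs.IsRightDescent w i) :
    bruhatLE cs w (w * cs.simple i) :=
  (bruhatLE_iff cs).mpr (.single (bruhatStep_mul_simple cs h))

theorem mul_simple_bruhatLE {w : W} {i : B} (h : cs.IsRightDescent w i) :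
    bruhatLE cs (w * cs.simple i) w := by
  have := bruhatLE_mul_simple cs (cs.isRightDescent_iff_not_isRightDescent_mul.mp h)
  simpa using this

theorem bruhatLE.mul_simple_le {cs : CoxeterSystem M W} {u w : W} (h : bruhatLE cs u w) {i : B}
    (hi : cs.IsRightDescent w i) : bruhatLE cs (u * cs.simple i) w := by
  rcases bruhatStep_mul_simple_left cs ((bruhatLE_iff cs).mp h) i with h | h
  · exact (bruhatLE_iff cs).mpr h
  · exact ((bruhatLE_iff cs).mpr h).trans (mul_simple_bruhatLE cs hi)

theorem bruhatLE.le_mul_simple {cs : CoxeterSystem M W} {u w : W} (h : bruhatLE cs u w) {i : B}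
    (hi : ¬ cs.IsRightDescent u i) : bruhatLE cs u (w * cs.simple i) := by
  rcases bruhatStep_mul_simple_right cs ((bruhatLE_iff cs).mp h) i with h | h
  · exact (bruhatLE_iff cs).mpr h
  · exact (bruhatLE_mul_simple cs hi).trans ((bruhatLE_iff cs).mpr h)

theorem bruhatLE.simple_mul_le {cs : CoxeterSystem M W} {u w : W} (h : bruhatLE cs u w) {i : B}
    (hi : cs.IsLeftDescent w i) : bruhatLE cs (cs.simple i * u) w := by
  have := (h.inv.mul_simple_le (cs.isRightDescent_inv_iff.mpr hi)).inv
  simpa using this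

theorem bruhatLE.le_simple_mul {cs : CoxeterSystem M W} {u w : W} (h : bruhatLE cs u w) {i : B}
    (hi : ¬ cs.IsLeftDescent u i) : bruhatLE cs u (cs.simple i * w) := by
  have := (h.inv.le_mul_simple (mt cs.isRightDescent_inv_iff.mp hi)).inv
  simpa using this

theorem bruhatLE.eq_or_length_lt {cs : CoxeterSystem M W} {u v : W} (h : bruhatLE cs u v) :
    u = v ∨ cs.length u < cs.length v := by
  rw [bruhatLE_iff] at h
  induction h with
  | refl => exact Or.inl rfl
  | tail _ hbc ih =>
    obtain ⟨_, _, _, hlt⟩ := hbc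
    right
    rcases ih with rfl | ih
    · exact hlt
    · exact ih.trans hlt

end Bruhat

section TwistedInvolutions

/-- `θ` is an involution of `W` permuting the simple reflections. -/
structure IsDiagramInvolution (cs : CoxeterSystem M W) (θ : W ≃* W) : Prop where
  involutive : Function.Involutive θ
  map_simple : ∀ i : B, ∃ j : B, θ (cs.simple i) = cs.simple j

variable {cs : CoxeterSystem M W} {θ : W ≃* W}

namespace IsDiagramInvolution

theorem length_map (h : IsDiagramInvolution cs θ) (w : W) : cs.length (θ w) = cs.length w := by
  choose f hf using h.map_simple
  have hmap : ∀ l : List B, θ (cs.wordProd l) = cs.wordProd (l.map f) := by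
    intro l
    induction l with
    | nil => simp
    | cons i l ih => simp [cs.wordProd_cons, hf, ih]
  have hle : ∀ x : W, cs.length (θ x) ≤ cs.length x := by
    intro x
    obtain ⟨l, hl, rfl⟩ := cs.exists_isReduced x
    rw [hmap, hl]
    exact (cs.length_wordProd_le _).trans_eq (by simp)
  refine le_antisymm (hle w) ?_
  simpa [h.involutive w] using hle (θ w)

theorem isReflection_map (h : IsDiagramInvolution cs θ) {t : W} (ht : cs.IsReflection t) :
    cs.IsReflection (θ t) := by
  obtain ⟨x, i, rfl⟩ := ht
  obtain ⟨j, hj⟩ := h.map_simple i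
  exact ⟨θ x, j, by simp [hj]⟩

theorem reflCocycle_map (h : IsDiagramInvolution cs θ) {t : W} (ht : cs.IsReflection t) (w : W) :
    reflCocycle cs (θ w) (θ t) = reflCocycle cs w t := by
  have h1 := reflCocycle_eq_one_iff cs ht w
  have h2 := reflCocycle_eq_one_iff cs (h.isReflection_map ht) (θ w)
  rw [← map_mul, h.length_map, h.length_map, ← h1] at h2
  rcases zmod_two_eq_zero_or_one (reflCocycle cs w t) with h0 | h0 <;>
    rcases zmod_two_eq_zero_or_one (reflCocycle cs (θ w) (θ t)) with h0' | h0' <;>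
    simp_all

end IsDiagramInvolution

theorem map_eq_inv {w : W} (hw : w ∈ twistedInvolutions θ) : θ w = w⁻¹ := hw

theorem mem_twistedInvolutions (h : IsDiagramInvolution cs θ) {w : W}
    (hw : w ∈ twistedIdentities θ) : w ∈ twistedInvolutions θ := by
  obtain ⟨v, rfl⟩ := hw
  change θ _ = _
  simp [h.involutive v]

theorem conj_mem_twistedIdentities {w : W} (hw : w ∈ twistedIdentities θ) (x : W) :
    θ x⁻¹ * w * x ∈ twistedIdentities θ := by
  obtain ⟨v, rfl⟩ := hw
  exact ⟨v * x, by simp [mul_assoc]⟩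

theorem simple_conj_mem_twistedIdentities {w : W} (hw : w ∈ twistedIdentities θ) (i : B) :
    θ (cs.simple i) * w * cs.simple i ∈ twistedIdentities θ := by
  simpa using conj_mem_twistedIdentities hw (cs.simple i)

theorem isLeftDescent_iff_isRightDescent (h : IsDiagramInvolution cs θ) {w : W}
    (hw : w ∈ twistedInvolutions θ) {i j : B} (hij : θ (cs.simple i) = cs.simple j) :
    cs.IsLeftDescent w j ↔ cs.IsRightDescent w i := by
  have : cs.simple j * w = θ (w * cs.simple i)⁻¹ := by
    rw [← hij, mul_inv_rev, map_mul, cs.inv_simple, map_inv, map_eq_inv hw, inv_inv]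
  rw [CoxeterSystem.IsLeftDescent, this, h.length_map, cs.length_inv]
  rfl

theorem twistAct_of_eq {w : W} {i : B} (h : θ (cs.simple i) * w * cs.simple i = w) :
    twistAct cs θ w i = w * cs.simple i :=
  if_pos h

theorem twistAct_of_ne {w : W} {i : B} (h : θ (cs.simple i) * w * cs.simple i ≠ w) :
    twistAct cs θ w i = θ (cs.simple i) * w * cs.simple i :=
  if_neg h

theorem map_simple_mul_of_eq {w : W} {i : B} (h : θ (cs.simple i) * w * cs.simple i = w) :
    θ (cs.simple i) * w = w * cs.simple i := by
  rw [← mul_inv_eq_iff_eq_mul, cs.inv_simple, h]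

theorem map_simple_mul_self (i : B) : θ (cs.simple i) * θ (cs.simple i) = 1 := by
  rw [← map_mul, cs.simple_mul_simple_self, map_one]

theorem twistAct_twistAct (w : W) (i : B) : twistAct cs θ (twistAct cs θ w i) i = w := by
  by_cases h : θ (cs.simple i) * w * cs.simple i = w
  · have h' := map_simple_mul_of_eq h
    rw [twistAct_of_eq h, twistAct_of_eq]
    · simp
    · simpa [mul_assoc] using h'
  · have h' : θ (cs.simple i) * (θ (cs.simple i) * w * cs.simple i) * cs.simple i = w := by
      simp only [← mul_assoc, map_simple_mul_self]
      simp
    rw [twistAct_of_ne h, twistAct_of_ne, h']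
    rw [h']
    exact Ne.symm h

theorem twistAct_mem (h : IsDiagramInvolution cs θ) {w : W} (hw : w ∈ twistedInvolutions θ)
    (i : B) : twistAct cs θ w i ∈ twistedInvolutions θ := by
  have hw' := map_eq_inv hw
  change θ _ = _
  by_cases hc : θ (cs.simple i) * w * cs.simple i = w
  · rw [twistAct_of_eq hc, ← map_simple_mul_of_eq hc, map_mul, h.involutive, hw',
      map_simple_mul_of_eq hc]
    simp
  · rw [twistAct_of_ne hc]
    simp [h.involutive (cs.simple i), hw', mul_assoc, ← map_inv]

theorem isRightDescent_twistAct (h : IsDiagramInvolution cs θ) {w : W} {i : B} :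
    cs.IsRightDescent (twistAct cs θ w i) i ↔ ¬ cs.IsRightDescent w i := by
  rw [← reflCocycle_simple_eq_one_iff, ← reflCocycle_simple_eq_zero_iff]
  suffices reflCocycle cs (twistAct cs θ w i) (cs.simple i) =
      1 + reflCocycle cs w (cs.simple i) by
    rw [this]
    rcases zmod_two_eq_zero_or_one (reflCocycle cs w (cs.simple i)) with h | h <;>
      simp [h, CharTwo.add_self_eq_zero]
  have hself := reflCocycle_self cs (cs.isReflection_simple i)
  by_cases hc : θ (cs.simple i) * w * cs.simple i = w
  · rw [twistAct_of_eq hc, reflCocycle_mul, hself, mul_inv_cancel_right]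
  · obtain ⟨j, hj⟩ := h.map_simple i
    rw [twistAct_of_ne hc, reflCocycle_mul, hself, mul_inv_cancel_right, hj, reflCocycle_mul,
      reflCocycle_simple, if_neg, add_zero]
    intro he
    apply hc
    rw [hj, ← he]
    simp [mul_assoc]

theorem length_twistAct (h : IsDiagramInvolution cs θ) {w : W} (hw : w ∈ twistedInvolutions θ)
    {i : B} (hc : θ (cs.simple i) * w * cs.simple i ≠ w) (hi : ¬ cs.IsRightDescent w i) :
    cs.length (θ (cs.simple i) * w * cs.simple i) = cs.length w + 2 := by
  obtain ⟨j, hj⟩ := h.map_simple i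
  have hd := (isRightDescent_twistAct h).mpr hi
  rw [twistAct_of_ne hc, cs.isRightDescent_iff, cs.simple_mul_simple_cancel_right] at hd
  have hl := (cs.not_isLeftDescent_iff).mp
    (mt (isLeftDescent_iff_isRightDescent h hw hj).mp hi)
  rw [← hd, hj, hl]

/-- The lifting property for twisted involutions, upwards. -/
theorem bruhatLE.le_twistAct (h : IsDiagramInvolution cs θ) {u w : W}
    (hu : u ∈ twistedInvolutions θ) (huw : bruhatLE cs u w) {i : B}
    (hi : ¬ cs.IsRightDescent u i) : bruhatLE cs u (twistAct cs θ w i) := by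
  by_cases hc : θ (cs.simple i) * w * cs.simple i = w
  · rw [twistAct_of_eq hc]
    exact huw.le_mul_simple hi
  · obtain ⟨j, hj⟩ := h.map_simple i
    rw [twistAct_of_ne hc, mul_assoc, hj]
    exact (huw.le_mul_simple hi).le_simple_mul
      (mt (isLeftDescent_iff_isRightDescent h hu hj).mp hi)

/-- The lifting property for twisted involutions, downwards. -/
theorem bruhatLE.twistAct_le (h : IsDiagramInvolution cs θ) {u w : W}
    (hw : w ∈ twistedInvolutions θ) (huw : bruhatLE cs u w) {i : B}
    (hi : cs.IsRightDescent w i) : bruhatLE cs (twistAct cs θ u i) w := by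
  by_cases hc : θ (cs.simple i) * u * cs.simple i = u
  · rw [twistAct_of_eq hc]
    exact huw.mul_simple_le hi
  · obtain ⟨j, hj⟩ := h.map_simple i
    rw [twistAct_of_ne hc, mul_assoc, hj]
    exact (huw.mul_simple_le hi).simple_mul_le
      ((isLeftDescent_iff_isRightDescent h hw hj).mpr hi)

theorem bruhatLE.twistAct_le_twistAct (h : IsDiagramInvolution cs θ) {u w : W}
    (hu : u ∈ twistedInvolutions θ) (hw : w ∈ twistedInvolutions θ) (huw : bruhatLE cs u w)
    {i : B} (hiu : cs.IsRightDescent u i) (hiw : cs.IsRightDescent w i) :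
    bruhatLE cs (twistAct cs θ u i) (twistAct cs θ w i) :=
  (huw.twistAct_le h hw hiw).le_twistAct h (twistAct_mem h hu i)
    (by rwa [isRightDescent_twistAct h, not_not])

theorem not_isRightDescent_of_eq (h : IsDiagramInvolution cs θ) {y : W}
    (hy : y ∈ twistedIdentities θ) {i : B} (hi : θ (cs.simple i) * y * cs.simple i = y) :
    ¬ cs.IsRightDescent y i := by
  have hc := map_simple_mul_of_eq hi
  obtain ⟨v, rfl⟩ := hy
  have hP : v * cs.simple i * v⁻¹ = θ (v * cs.simple i * v⁻¹) := by
    have := congrArg (fun z => θ v * z * v⁻¹) hc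
    simpa [mul_assoc] using this.symm
  rw [← reflCocycle_simple_eq_zero_iff, reflCocycle_mul, hP,
    h.reflCocycle_map ((cs.isReflection_simple i).conj v), reflCocycle_inv_conj,
    CharTwo.add_self_eq_zero]

theorem simple_conj_ne_of_isRightDescent (h : IsDiagramInvolution cs θ) {y : W}
    (hy : y ∈ twistedIdentities θ) {i : B} (hi : cs.IsRightDescent y i) :
    θ (cs.simple i) * y * cs.simple i ≠ y :=
  fun he => not_isRightDescent_of_eq h hy he hi

theorem twistAct_mem_twistedIdentities (h : IsDiagramInvolution cs θ) {y : W}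
    (hy : y ∈ twistedIdentities θ) {i : B} (hi : cs.IsRightDescent y i) :
    twistAct cs θ y i ∈ twistedIdentities θ := by
  rw [twistAct_of_ne (simple_conj_ne_of_isRightDescent h hy hi)]
  exact simple_conj_mem_twistedIdentities hy i

/-- If `w` and `w ⋅ s̲` are twisted identities then `w ⋅ s̲ = θ(s) w s`. -/
theorem simple_conj_ne_of_twistAct_mem (h : IsDiagramInvolution cs θ) {w : W} {i : B}
    (hw : ¬ cs.IsRightDescent w i) (hm : twistAct cs θ w i ∈ twistedIdentities θ) :
    θ (cs.simple i) * w * cs.simple i ≠ w := by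
  intro he
  have hne := simple_conj_ne_of_isRightDescent h hm ((isRightDescent_twistAct h).mpr hw)
  rw [twistAct_of_eq he] at hne
  apply hne
  rw [← map_simple_mul_of_eq he, ← mul_assoc, map_simple_mul_self, one_mul,
    map_simple_mul_of_eq he]

end TwistedInvolutions

section Parabolic

variable (cs : CoxeterSystem M W) (J : Set B)

/-- The standard parabolic subgroup generated by the simple reflections indexed by `J`. -/
def parabolic : Subgroup W := Subgroup.closure (cs.simple '' J)

variable {cs J}

theorem simple_mem_parabolic {i : B} (hi : i ∈ J) : cs.simple i ∈ parabolic cs J :=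
  Subgroup.subset_closure ⟨i, hi, rfl⟩

theorem wordProd_mem_parabolic {l : List B} (hl : ∀ i ∈ l, i ∈ J) :
    cs.wordProd l ∈ parabolic cs J := by
  induction l with
  | nil => simp
  | cons i l ih =>
    rw [cs.wordProd_cons]
    exact mul_mem (simple_mem_parabolic (hl i (by simp))) (ih fun j hj => hl j (by simp [hj]))

theorem exists_reduced_mul_simple {l : List B} (hl : cs.IsReduced l) (hJ : ∀ i ∈ l, i ∈ J)
    {j : B} (hj : j ∈ J) : ∃ l' : List B, cs.IsReduced l' ∧ (∀ i ∈ l', i ∈ J) ∧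
      cs.wordProd l' = cs.wordProd l * cs.simple j := by
  by_cases hd : cs.IsRightDescent (cs.wordProd l) j
  · obtain ⟨k, hk, he⟩ := strong_exchange cs (cs.isReflection_simple j) hd
    refine ⟨l.eraseIdx k, ?_, fun i hi => hJ i (List.mem_of_mem_eraseIdx hi), he.symm⟩
    rw [cs.isRightDescent_iff, hl] at hd
    rw [CoxeterSystem.IsReduced, ← he, List.length_eraseIdx_of_lt hk]
    omega
  · refine ⟨l ++ [j], ?_, ?_, by simp [cs.wordProd_append]⟩
    · rw [cs.not_isRightDescent_iff, hl] at hd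
      rw [CoxeterSystem.IsReduced, cs.wordProd_append, cs.wordProd_singleton, hd]
      simp
    · intro i hi
      rcases List.mem_append.mp hi with hi | hi
      · exact hJ i hi
      · rwa [List.mem_singleton.mp hi]

theorem exists_reduced_of_mem_parabolic {w : W} (hw : w ∈ parabolic cs J) :
    ∃ l : List B, cs.IsReduced l ∧ (∀ i ∈ l, i ∈ J) ∧ cs.wordProd l = w := by
  induction hw using Subgroup.closure_induction_right with
  | one => exact ⟨[], by simp [CoxeterSystem.IsReduced], by simp, by simp⟩
  | mul_right x hx y hy ih =>
    obtain ⟨i, hi, rfl⟩ := hy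
    obtain ⟨l, hl, hJ, rfl⟩ := ih
    exact exists_reduced_mul_simple hl hJ hi
  | mul_inv_cancel x hx y hy ih =>
    obtain ⟨i, hi, rfl⟩ := hy
    obtain ⟨l, hl, hJ, rfl⟩ := ih
    rw [cs.inv_simple]
    exact exists_reduced_mul_simple hl hJ hi

theorem exists_isRightDescent_of_mem_parabolic {w : W} (hw : w ∈ parabolic cs J) (h1 : w ≠ 1) :
    ∃ i ∈ J, cs.IsRightDescent w i := by
  obtain ⟨l, hl, hJ, rfl⟩ := exists_reduced_of_mem_parabolic hw
  rcases List.eq_nil_or_concat' l with rfl | ⟨l', i, rfl⟩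
  · simp at h1
  · refine ⟨i, hJ i (by simp), ?_⟩
    have h2 := cs.length_wordProd_le l'
    rw [CoxeterSystem.IsRightDescent, hl, cs.wordProd_append]
    simp
    omega

theorem eq_simple_of_mem_parabolic {w : W} (hw : w ∈ parabolic cs J) (h1 : cs.length w = 1) :
    ∃ i ∈ J, w = cs.simple i := by
  obtain ⟨l, hl, hJ, rfl⟩ := exists_reduced_of_mem_parabolic hw
  rw [hl] at h1
  obtain ⟨i, rfl⟩ := List.length_eq_one_iff.mp h1
  exact ⟨i, hJ i (by simp), by simp⟩

theorem mem_parabolic_of_mem_rightInvSeq {l : List B} (hJ : ∀ i ∈ l, i ∈ J) {t : W}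
    (ht : t ∈ cs.rightInvSeq l) : t ∈ parabolic cs J := by
  induction l with
  | nil => simp at ht
  | cons i l ih =>
    simp only [CoxeterSystem.rightInvSeq, List.mem_cons] at ht
    have hl : ∀ j ∈ l, j ∈ J := fun j hj => hJ j (by simp [hj])
    rcases ht with rfl | ht
    · have hm := wordProd_mem_parabolic (cs := cs) hl
      exact mul_mem (mul_mem (inv_mem hm) (simple_mem_parabolic (hJ i (by simp)))) hm
    · exact ih hl ht

theorem mem_parabolic_of_reflCocycle_eq_one {w t : W} (hw : w ∈ parabolic cs J)
    (ht : reflCocycle cs w t = 1) : t ∈ parabolic cs J := by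
  obtain ⟨l, -, hJ, rfl⟩ := exists_reduced_of_mem_parabolic hw
  by_contra hn
  rw [reflCocycle_wordProd_eq_zero cs fun h => hn (mem_parabolic_of_mem_rightInvSeq hJ h)] at ht
  exact zero_ne_one ht

theorem exists_min_parabolic_coset (w : W) : ∃ g ∈ parabolic cs J,
    ∀ t ∈ parabolic cs J, cs.IsReflection t → reflCocycle cs (w * g) t = 0 := by
  have hex : ∃ n, ∃ g ∈ parabolic cs J, cs.length (w * g) = n := ⟨_, 1, one_mem _, rfl⟩
  obtain ⟨g, hg, hn⟩ := Nat.find_spec hex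
  refine ⟨g, hg, fun t ht htr => ?_⟩
  have hmin := Nat.find_min' hex ⟨g * t, mul_mem hg ht, rfl⟩
  rw [← hn, ← mul_assoc] at hmin
  rw [reflCocycle_eq_zero_iff cs htr]
  exact lt_of_le_of_ne hmin (htr.length_mul_left_ne _).symm

theorem reflCocycle_eq_zero_of_mem_parabolic {m : W} (hm : ∀ i ∈ J, ¬ cs.IsRightDescent m i)
    {t : W} (ht : t ∈ parabolic cs J) (htr : cs.IsReflection t) : reflCocycle cs m t = 0 := by
  obtain ⟨g, hg, hmin⟩ := exists_min_parabolic_coset (cs := cs) (J := J) m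
  by_cases h1 : g = 1
  · subst h1
    simpa using hmin t ht htr
  · exfalso
    obtain ⟨i, hi, hd⟩ := exists_isRightDescent_of_mem_parabolic (inv_mem hg)
      (inv_ne_one.mpr h1)
    apply hm i hi
    rw [← reflCocycle_simple_eq_one_iff] at hd ⊢
    rw [show m = m * g * g⁻¹ by group, reflCocycle_mul, hd, hmin, add_zero]
    · exact mul_mem (mul_mem (inv_mem hg) (simple_mem_parabolic hi)) (inv_mem (inv_mem hg))
    · exact (cs.isReflection_simple i).conj _

theorem reflCocycle_mul_parabolic {m : W} (hm : ∀ i ∈ J, ¬ cs.IsRightDescent m i) {w t : W}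
    (hw : w ∈ parabolic cs J) (ht : t ∈ parabolic cs J) (htr : cs.IsReflection t) :
    reflCocycle cs (m * w) t = reflCocycle cs w t := by
  rw [reflCocycle_mul, reflCocycle_eq_zero_of_mem_parabolic hm
    (mul_mem (mul_mem hw ht) (inv_mem hw)) (htr.conj w), add_zero]

theorem isRightDescent_mul_parabolic {m : W} (hm : ∀ i ∈ J, ¬ cs.IsRightDescent m i) {w : W}
    (hw : w ∈ parabolic cs J) {i : B} (hi : i ∈ J) :
    cs.IsRightDescent (m * w) i ↔ cs.IsRightDescent w i := by
  rw [← reflCocycle_simple_eq_one_iff, ← reflCocycle_simple_eq_one_iff,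
    reflCocycle_mul_parabolic hm hw (simple_mem_parabolic hi) (cs.isReflection_simple i)]

theorem length_mul_parabolic {m : W} (hm : ∀ i ∈ J, ¬ cs.IsRightDescent m i) {w : W}
    (hw : w ∈ parabolic cs J) : cs.length (m * w) = cs.length m + cs.length w := by
  obtain ⟨l, hl, hJ, rfl⟩ := exists_reduced_of_mem_parabolic hw
  clear hw
  induction l using List.reverseRecOn with
  | nil => simp
  | append_singleton l i ih =>
    have hl0 : cs.IsReduced l := by simpa using hl.take l.length
    have hJ0 : ∀ j ∈ l, j ∈ J := fun j hj => hJ j (by simp [hj])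
    have hd : ¬ cs.IsRightDescent (cs.wordProd l) i := by
      rw [cs.not_isRightDescent_iff, hl0, ← cs.wordProd_singleton, ← cs.wordProd_append, hl]
      simp
    have hd' := mt (isRightDescent_mul_parabolic hm (wordProd_mem_parabolic hJ0)
      (hJ i (by simp))).mp hd
    rw [hl, cs.wordProd_append, cs.wordProd_singleton, ← mul_assoc,
      cs.not_isRightDescent_iff.mp hd', ih hl0 hJ0, hl0]
    simp [add_assoc]

theorem exists_parabolic_decomposition (w : W) : ∃ m, ∃ g ∈ parabolic cs J,
    w = m * g ∧ ∀ i ∈ J, ¬ cs.IsRightDescent m i := by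
  obtain ⟨g, hg, hmin⟩ := exists_min_parabolic_coset (cs := cs) (J := J) w
  refine ⟨w * g, g⁻¹, inv_mem hg, by simp, fun i hi => ?_⟩
  rw [← reflCocycle_simple_eq_zero_iff]
  exact hmin _ (simple_mem_parabolic hi) (cs.isReflection_simple i)

theorem eq_of_mul_parabolic_eq {m m' g g' : W} (hm : ∀ i ∈ J, ¬ cs.IsRightDescent m i)
    (hm' : ∀ i ∈ J, ¬ cs.IsRightDescent m' i) (hg : g ∈ parabolic cs J)
    (hg' : g' ∈ parabolic cs J) (h : m * g = m' * g') : m = m' := by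
  have h1 : m' = m * (g * g'⁻¹) := by rw [← mul_assoc, h, mul_inv_cancel_right]
  have h2 : m = m' * (g' * g⁻¹) := by rw [← mul_assoc, ← h, mul_inv_cancel_right]
  have h3 := length_mul_parabolic hm (mul_mem hg (inv_mem hg'))
  have h4 := length_mul_parabolic hm' (mul_mem hg' (inv_mem hg))
  rw [← h1] at h3
  rw [← h2] at h4
  have h5 : cs.length (g * g'⁻¹) = 0 := by omega
  rw [cs.length_eq_zero_iff] at h5
  rw [h1, h5, mul_one]

theorem dihedral_form {G : Type*} [Group G] {x y : G} (hx : x * x = 1) (hy : y * y = 1) {g : G}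
    (hg : g ∈ Subgroup.closure {x, y}) :
    ∃ k : ℤ, g = (x * y) ^ k ∨ g = (x * y) ^ k * x := by
  have hx' : x⁻¹ = x := inv_eq_of_mul_eq_one_left hx
  have hy' : y⁻¹ = y := inv_eq_of_mul_eq_one_left hy
  have hr : ∀ k : ℤ, (x * y) ^ k * x * y = (x * y) ^ (k + 1) := fun k => by
    rw [zpow_add_one, mul_assoc]
  have hf : ∀ k : ℤ, (x * y) ^ k * y = (x * y) ^ (k - 1) * x := fun k => by
    rw [zpow_sub_one, mul_inv_rev, hx', hy']
    simp only [mul_assoc, hx, mul_one]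
  have hmul : ∀ {g z : G}, (z = x ∨ z = y) → (∃ k : ℤ, g = (x * y) ^ k ∨ g = (x * y) ^ k * x) →
      ∃ k : ℤ, g * z = (x * y) ^ k ∨ g * z = (x * y) ^ k * x := by
    rintro g z (rfl | rfl) ⟨k, rfl | rfl⟩
    · exact ⟨k, Or.inr rfl⟩
    · exact ⟨k, Or.inl (by rw [mul_assoc, hx, mul_one])⟩
    · exact ⟨k - 1, Or.inr (hf k)⟩
    · exact ⟨k + 1, Or.inl (hr k)⟩
  induction hg using Subgroup.closure_induction_right with
  | one => exact ⟨0, Or.inl (by simp)⟩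
  | mul_right g _ z hz ih => exact hmul hz ih
  | mul_inv_cancel g _ z hz ih =>
    refine hmul ?_ ih
    rcases hz with rfl | rfl
    · exact Or.inl hx'
    · exact Or.inr hy'

theorem parabolic_pair (i j : B) :
    parabolic cs {i, j} = Subgroup.closure {cs.simple i, cs.simple j} := by
  rw [parabolic, Set.image_pair]

theorem dihedral_form_of_mem_parabolic {i j : B} {g : W} (hg : g ∈ parabolic cs {i, j}) :
    ∃ k : ℤ, g = (cs.simple i * cs.simple j) ^ k ∨
      g = (cs.simple i * cs.simple j) ^ k * cs.simple i := by
  rw [parabolic_pair] at hg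
  exact dihedral_form (cs.simple_mul_simple_self i) (cs.simple_mul_simple_self j) hg

end Parabolic

section ReflectionCommute

variable {cs : CoxeterSystem M W} {θ : W ≃* W}

theorem commute_simple_of_map_eq (h : IsDiagramInvolution cs θ) {i : B}
    (hi : θ (cs.simple i) = cs.simple i) {p : W}
    (hp : θ p = cs.simple i * p * cs.simple i) : p * cs.simple i = cs.simple i * p := by
  by_contra hne
  have hl : cs.length (cs.simple i * p) = cs.length (p * cs.simple i) := by
    rw [← h.length_map (p * cs.simple i), map_mul, hp, hi]
    simp [mul_assoc]
  have hl' : cs.length (cs.simple i * p * cs.simple i) = cs.length p := by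
    rw [← hp, h.length_map]
  have hn : reflCocycle cs (cs.simple i * p) (cs.simple i) =
      reflCocycle cs p (cs.simple i) := by
    rw [reflCocycle_mul, reflCocycle_simple, if_neg, add_zero]
    rwa [mul_inv_eq_iff_eq_mul]
  have hd : cs.IsRightDescent (cs.simple i * p) i ↔ cs.IsRightDescent p i := by
    rw [← reflCocycle_simple_eq_one_iff, hn, reflCocycle_simple_eq_one_iff]
  by_cases hpd : cs.IsRightDescent p i
  · have h1 := cs.isRightDescent_iff.mp hpd
    have h2 := cs.isRightDescent_iff.mp (hd.mpr hpd)
    omega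
  · have h1 := cs.not_isRightDescent_iff.mp hpd
    have h2 := cs.not_isRightDescent_iff.mp (mt hd.mp hpd)
    omega

theorem simple_mul_zpow_mul_simple (i j : B) (k : ℤ) :
    cs.simple i * (cs.simple i * cs.simple j) ^ k * cs.simple i =
      (cs.simple i * cs.simple j) ^ (-k) := by
  have h := conj_zpow (i := k) (a := cs.simple i) (b := cs.simple i * cs.simple j)
  rw [cs.inv_simple] at h
  rw [← h, zpow_neg, ← inv_zpow]
  simp

theorem simple_mul_zpow_mul_simple' (i j : B) (k : ℤ) :
    cs.simple i * (cs.simple j * cs.simple i) ^ k * cs.simple i =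
      (cs.simple j * cs.simple i) ^ (-k) := by
  have h := conj_zpow (i := k) (a := cs.simple i) (b := cs.simple j * cs.simple i)
  rw [cs.inv_simple] at h
  rw [← h, zpow_neg, ← inv_zpow]
  simp [mul_assoc]

theorem simple_mul_simple_zpow_inv (i j : B) (k : ℤ) :
    (cs.simple i * cs.simple j) ^ (-k) = (cs.simple j * cs.simple i) ^ k := by
  rw [zpow_neg, ← inv_zpow]
  simp

/-- Under the NOF property, the elements of a flipped dihedral subgroup fixed by `θ` are central
rotations. -/
theorem eq_zpow_of_map_eq (hNOF : NOF cs θ) {i j : B} (hij : θ (cs.simple i) = cs.simple j)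
    (hji : θ (cs.simple j) = cs.simple i) (hne : cs.simple i ≠ cs.simple j) {g : W}
    (hg : g ∈ parabolic cs {i, j}) (hθg : θ g = g) :
    ∃ k : ℤ, g = (cs.simple i * cs.simple j) ^ k ∧ g = (cs.simple j * cs.simple i) ^ k := by
  obtain ⟨k, rfl | rfl⟩ := dihedral_form_of_mem_parabolic hg
  · refine ⟨k, rfl, ?_⟩
    rw [← hθg, map_zpow, map_mul, hij, hji]
  · exfalso
    rw [map_mul, map_zpow, map_mul, hij, hji, ← simple_mul_simple_zpow_inv] at hθg
    have h1 : (cs.simple i * cs.simple j) ^ (2 * k + 1) = 1 := by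
      have h2 : (cs.simple i * cs.simple j) ^ k *
          ((cs.simple i * cs.simple j) ^ k * cs.simple i) * cs.simple j = 1 := by
        rw [← hθg, ← mul_assoc, ← zpow_add]
        simp
      rw [← h2, zpow_add_one, two_mul, zpow_add]
      simp only [mul_assoc]
    rw [← orderOf_dvd_iff_zpow_eq_one] at h1
    have h3 := hNOF i (by rw [hij]; exact hne.symm)
    rw [hij] at h3
    rcases h3 with h3 | h3
    · obtain ⟨r, hr⟩ := h3
      rw [hr] at h1
      have : (2 : ℤ) ∣ 2 * k + 1 := dvd_trans ⟨r, by push_cast; ring⟩ h1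
      omega
    · rw [h3, Nat.cast_zero, zero_dvd_iff] at h1
      omega

theorem reflCocycle_conj_of_swap {q : W} {i j : B} (hqi : q * cs.simple i = cs.simple j * q)
    {x : W} (hx : x ≠ cs.simple i) :
    reflCocycle cs q (cs.simple i * x * cs.simple i) = reflCocycle cs q x := by
  have hq : q = cs.simple j * (q * cs.simple i) := by simp [hqi]
  have hq' : q * cs.simple i * x * (q * cs.simple i)⁻¹ ≠ cs.simple j := by
    intro he
    apply hx
    rw [mul_inv_eq_iff_eq_mul, ← mul_assoc, ← hqi, mul_assoc, mul_assoc q] at he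
    exact mul_left_cancel (mul_left_cancel he)
  conv_rhs => rw [hq, reflCocycle_mul, reflCocycle_mul, reflCocycle_simple, if_neg hx,
    reflCocycle_simple, if_neg hq', zero_add, add_zero, cs.inv_simple]

theorem reflCocycle_mul_zpow_eq_one {q : W} (hq : cs.IsReflection q) {i j : B}
    (hqi : q * cs.simple i = cs.simple j * q) (hqj : q * cs.simple j = cs.simple i * q)
    (hmem : q ∉ parabolic cs {i, j}) (k : ℤ) :
    reflCocycle cs q (q * (cs.simple j * cs.simple i) ^ k) = 1 := by
  have hi : cs.simple i ∈ parabolic cs {i, j} := simple_mem_parabolic (by simp)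
  have hj : cs.simple j ∈ parabolic cs {i, j} := simple_mem_parabolic (by simp)
  have hne : ∀ (k : ℤ), ∀ z ∈ parabolic cs {i, j},
      q * (cs.simple j * cs.simple i) ^ k ≠ z := by
    rintro k z hz rfl
    exact hmem ((Subgroup.mul_mem_cancel_right _ (zpow_mem (mul_mem hj hi) k)).mp hz)
  have h1 : ∀ k : ℤ, reflCocycle cs q (q * (cs.simple j * cs.simple i) ^ (1 - k)) =
      reflCocycle cs q (q * (cs.simple j * cs.simple i) ^ k) := by
    intro k
    rw [← reflCocycle_conj_of_swap hqi (hne k _ hi)]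
    congr 1
    rw [← mul_assoc, ← hqj, mul_assoc q, mul_assoc q, sub_eq_add_neg, zpow_one_add,
      ← simple_mul_zpow_mul_simple' i j k]
    simp [mul_assoc]
  have h2 : ∀ k : ℤ, reflCocycle cs q (q * (cs.simple j * cs.simple i) ^ (-1 - k)) =
      reflCocycle cs q (q * (cs.simple j * cs.simple i) ^ k) := by
    intro k
    rw [← reflCocycle_conj_of_swap hqj (hne k _ hj)]
    congr 1
    rw [← mul_assoc, ← hqi, mul_assoc q, mul_assoc q, sub_eq_add_neg, zpow_add, zpow_neg_one,
      ← simple_mul_zpow_mul_simple j i k]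
    simp [mul_assoc]
  have h0 : reflCocycle cs q (q * (cs.simple j * cs.simple i) ^ (0 : ℤ)) = 1 := by
    simpa using reflCocycle_self cs hq
  have h3 : ∀ k : ℤ, reflCocycle cs q (q * (cs.simple j * cs.simple i) ^ (k + 2)) =
      reflCocycle cs q (q * (cs.simple j * cs.simple i) ^ k) := by
    intro k
    rw [← h2 k, ← h1]
    congr 3
    ring
  suffices hs : reflCocycle cs q (q * (cs.simple j * cs.simple i) ^ k) = 1 ∧
      reflCocycle cs q (q * (cs.simple j * cs.simple i) ^ (k + 1)) = 1 from hs.1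
  induction k using Int.induction_on with
  | zero => exact ⟨h0, by rw [← h1]; simpa using h0⟩
  | succ k ih => exact ⟨ih.2, by rw [add_assoc, one_add_one_eq_two, h3, ih.1]⟩
  | pred k ih =>
    refine ⟨?_, by rw [sub_add_cancel, ih.1]⟩
    rw [← h3, ← ih.2]
    congr 3
    ring

theorem IsDiagramInvolution.isRightDescent_map (h : IsDiagramInvolution cs θ) {i j : B}
    (hij : θ (cs.simple i) = cs.simple j) (w : W) :
    cs.IsRightDescent (θ w) j ↔ cs.IsRightDescent w i := by
  rw [CoxeterSystem.IsRightDescent, ← hij, ← map_mul, h.length_map, h.length_map]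
  rfl

theorem map_mem_parabolic_pair {i j : B} (hij : θ (cs.simple i) = cs.simple j)
    (hji : θ (cs.simple j) = cs.simple i) {g : W} (hg : g ∈ parabolic cs {i, j}) :
    θ g ∈ parabolic cs {i, j} := by
  have hle : parabolic cs {i, j} ≤ (parabolic cs {i, j}).comap θ.toMonoidHom := by
    refine (Subgroup.closure_le _).mpr ?_
    rintro _ ⟨k, hk, rfl⟩
    change θ (cs.simple k) ∈ parabolic cs {i, j}
    rcases hk with rfl | rfl
    · rw [hij]
      exact simple_mem_parabolic (by simp)
    · rw [hji]
      exact simple_mem_parabolic (by simp)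
  exact hle hg

theorem not_isRightDescent_of_reduced_conj (hNOF : NOF cs θ) {i j : B}
    (hij : θ (cs.simple i) = cs.simple j) (hji : θ (cs.simple j) = cs.simple i)
    (hne : cs.simple i ≠ cs.simple j) {m g : W} (hq : cs.IsReflection (g * m⁻¹))
    (hg : g ∈ parabolic cs {i, j}) (hg1 : g ≠ 1) (hθm : θ m = m) (hθg : θ g = g)
    (hm : ∀ k ∈ ({i, j} : Set B), ¬ cs.IsRightDescent m k)
    (hm' : ∀ k ∈ ({i, j} : Set B), ¬ cs.IsRightDescent m⁻¹ k) :
    ¬ cs.IsRightDescent (g * m⁻¹) i := by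
  intro hi
  have hiJ : i ∈ ({i, j} : Set B) := by simp
  have hin := (reflCocycle_simple_eq_one_iff cs _ i).mpr hi
  have hθm' : θ m⁻¹ = m⁻¹ := by rw [map_inv, hθm]
  obtain ⟨k, hk, hk'⟩ := eq_zpow_of_map_eq hNOF hij hji hne hg hθg
  have hgi : g * cs.simple i = cs.simple i * g := by
    have := simple_mul_zpow_mul_simple (cs := cs) i j k
    rw [simple_mul_simple_zpow_inv, ← hk, ← hk'] at this
    conv_lhs => rw [← this]
    simp
  have hgj : g * cs.simple j = cs.simple j * g := by
    have := congrArg θ hgi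
    rwa [map_mul, map_mul, hθg, hij] at this
  have hmem : m⁻¹ * cs.simple i * (m⁻¹)⁻¹ ∈ parabolic cs {i, j} := by
    rw [reflCocycle_mul, (reflCocycle_simple_eq_zero_iff cs _ _).mpr (hm' i hiJ), zero_add] at hin
    exact mem_parabolic_of_reflCocycle_eq_one hg hin
  have hr1 : cs.length (m⁻¹ * cs.simple i * (m⁻¹)⁻¹) = 1 := by
    have h1 := length_mul_parabolic hm hmem
    have h2 := cs.not_isRightDescent_iff.mp (hm' i hiJ)
    rw [← cs.length_inv] at h2
    simp only [mul_inv_rev, inv_inv, cs.inv_simple, cs.length_inv] at h2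
    simp only [inv_inv, mul_assoc, mul_inv_cancel_left] at h1
    rw [inv_inv, mul_assoc]
    omega
  obtain ⟨r, rfl | rfl, hr⟩ := eq_simple_of_mem_parabolic hmem hr1
  · rw [mul_inv_eq_iff_eq_mul] at hr
    have hc : g * m⁻¹ * cs.simple r = cs.simple r * (g * m⁻¹) := by
      rw [mul_assoc, hr, ← mul_assoc, hgi, mul_assoc]
    rw [reflCocycle_eq_zero_of_commute cs hq hc] at hin
    · exact zero_ne_one hin
    · intro he
      apply hne
      rw [← hij, he, map_mul, hθg, hθm']
  · rw [mul_inv_eq_iff_eq_mul] at hr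
    have hr' : m⁻¹ * cs.simple r = cs.simple i * m⁻¹ := by
      have := congrArg θ hr
      rwa [map_mul, map_mul, hθm', hij, hji] at this
    have hqi : g * m⁻¹ * cs.simple i = cs.simple r * (g * m⁻¹) := by
      rw [mul_assoc, hr, ← mul_assoc, hgj, mul_assoc]
    have hqj : g * m⁻¹ * cs.simple r = cs.simple i * (g * m⁻¹) := by
      rw [mul_assoc, hr', ← mul_assoc, hgi, mul_assoc]
    have hmem : g * m⁻¹ ∉ parabolic cs {i, r} := by
      intro hmem
      have hm1 := (Subgroup.mul_mem_cancel_left _ hg).mp hmem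
      have : m⁻¹ = 1 := by
        by_contra hne1
        obtain ⟨l, hl, hd⟩ := exists_isRightDescent_of_mem_parabolic hm1 hne1
        exact hm' l hl hd
      rw [this] at hr
      exact hne (by simpa using hr)
    have h1 := reflCocycle_mul_zpow_eq_one hq hqi hqj hmem k
    rw [← hk'] at h1
    have hmg : m⁻¹ * g = g * m⁻¹ := by
      have := conj_zpow (i := k) (a := m⁻¹) (b := cs.simple i * cs.simple r)
      rw [← hk, ← mul_assoc, hr, mul_assoc _ m⁻¹, hr', ← mul_assoc, mul_inv_cancel_right,
        ← hk'] at this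
      exact mul_inv_eq_iff_eq_mul.mp this.symm
    rw [reflCocycle_eq_zero_of_commute cs hq] at h1
    · exact zero_ne_one h1
    · rw [mul_assoc (g * m⁻¹) g, mul_assoc g m⁻¹ g, hmg]
    · simpa using hg1

theorem commute_of_map_eq (h : IsDiagramInvolution cs θ) (hNOF : NOF cs θ) {q p : W}
    (hq : cs.IsReflection q) (hθq : θ q = q) (hp : θ p = q * p * q) : p * q = q * p := by
  induction hn : cs.length q using Nat.strong_induction_on generalizing q p with
  | h n ih =>
  subst hn
  have hconj : ∀ x : W, θ x = x → cs.length (x * q * x⁻¹) < cs.length q → p * q = q * p := by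
    intro x hx hlt
    have := ih _ hlt (q := x * q * x⁻¹) (p := x * p * x⁻¹) (hq.conj x) (by simp [hx, hθq])
      (by simp [hx, hp, mul_assoc]) rfl
    exact mul_right_cancel (b := x⁻¹) (by simpa [mul_assoc] using this)
  have hq1 : q ≠ 1 := by
    rintro rfl
    simpa using hq.odd_length
  obtain ⟨i, hi⟩ := cs.exists_rightDescent_of_ne_one hq1
  obtain ⟨j, hij⟩ := h.map_simple i
  have hji : θ (cs.simple j) = cs.simple i := by rw [← hij, h.involutive]
  have hin := (reflCocycle_simple_eq_one_iff cs q i).mpr hi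
  have hcomm : ∀ {k : B}, cs.IsRightDescent q k → q ≠ cs.simple k →
      q * cs.simple k ≠ cs.simple k * q := by
    intro k hk hne he
    rw [← reflCocycle_simple_eq_one_iff, reflCocycle_eq_zero_of_commute cs hq he hne.symm] at hk
    exact zero_ne_one hk
  by_cases hqi : q = cs.simple i
  · subst hqi
    exact commute_simple_of_map_eq h hθq hp
  by_cases hs : cs.simple i = cs.simple j
  · apply hconj (cs.simple i) (hij.trans hs.symm)
    rw [cs.inv_simple]
    have hne := hcomm hi hqi
    have h1 : cs.IsRightDescent (cs.simple i * q) i := by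
      rw [← reflCocycle_simple_eq_one_iff, reflCocycle_mul, hin, reflCocycle_simple, if_neg,
        add_zero]
      rwa [mul_inv_eq_iff_eq_mul]
    have h2 : cs.IsLeftDescent q i := by
      rwa [← cs.isRightDescent_inv_iff, hq.inv]
    exact lt_trans h1 h2
  · obtain ⟨m, g, hg, hqm, hm⟩ := exists_parabolic_decomposition (cs := cs) (J := {i, j}) q
    have hθmg : θ m * θ g = m * g := by rw [← map_mul, ← hqm, hθq]
    have hθm : θ m = m := by
      refine eq_of_mul_parabolic_eq ?_ hm (map_mem_parabolic_pair hij hji hg) hg hθmg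
      rintro k (rfl | rfl)
      · rw [h.isRightDescent_map hji]
        exact hm j (by simp)
      · rw [h.isRightDescent_map hij]
        exact hm i (by simp)
    have hθg : θ g = g := by
      rw [hθm] at hθmg
      exact mul_left_cancel hθmg
    have hj : cs.IsRightDescent q j := by
      rw [← hθq, h.isRightDescent_map hij]
      exact hi
    have hgd : ∀ k ∈ ({i, j} : Set B), cs.IsRightDescent g k := by
      intro k hk
      rw [← isRightDescent_mul_parabolic hm hg hk, ← hqm]
      rcases hk with rfl | rfl
      · exact hi
      · exact hj
    by_cases hm' : ∀ k ∈ ({i, j} : Set B), ¬ cs.IsRightDescent m⁻¹ k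
    · have hqg : q = g⁻¹ * m⁻¹ := by rw [← mul_inv_rev, ← hqm, hq.inv]
      have hg1 : g⁻¹ ≠ 1 := by
        intro hg1
        have := hgd i (by simp)
        simp [inv_eq_one.mp hg1, CoxeterSystem.IsRightDescent] at this
      exact absurd (hqg ▸ hi) (not_isRightDescent_of_reduced_conj hNOF hij hji hs (hqg ▸ hq)
        (inv_mem hg) hg1 hθm (by rw [map_inv, hθg]) hm hm')
    · push Not at hm'
      obtain ⟨k, hk, hmk⟩ := hm'
      apply hconj g hθg
      rw [cs.isRightDescent_inv_iff, cs.isLeftDescent_iff] at hmk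
      have h1 := cs.isRightDescent_iff.mp (hgd k hk)
      have h2 : g * q * g⁻¹ = (g * cs.simple k) * (cs.simple k * m) := by
        simp [hqm, mul_assoc]
      have h3 := cs.length_mul_le (g * cs.simple k) (cs.simple k * m)
      have h4 := length_mul_parabolic hm hg
      rw [← hqm] at h4
      rw [h2]
      omega

end ReflectionCommute

section DihedralReflections

variable {cs : CoxeterSystem M W} {θ : W ≃* W}

theorem not_isReflection_zpow (i j : B) (k : ℤ) :
    ¬ cs.IsReflection ((cs.simple i * cs.simple j) ^ k) := by
  intro hr
  have h1 := hr.odd_length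
  have h2 : cs.lengthParity ((cs.simple i * cs.simple j) ^ k) = 1 := by
    rw [map_zpow, map_mul, cs.lengthParity_simple, cs.lengthParity_simple]
    have : Multiplicative.ofAdd (1 : ZMod 2) * Multiplicative.ofAdd 1 = 1 := by decide
    rw [this, one_zpow]
  rw [cs.lengthParity_eq_ofAdd_length] at h2
  have h3 : ((cs.length ((cs.simple i * cs.simple j) ^ k) : ℕ) : ZMod 2) = 0 := h2
  rw [ZMod.natCast_eq_zero_iff_even] at h3
  exact (Nat.not_even_iff_odd.mpr h1) h3

theorem length_map_mul (h : IsDiagramInvolution cs θ) {m : W} (hm : m ∈ twistedInvolutions θ)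
    (w : W) : cs.length (θ w * m) = cs.length (m * w⁻¹) := by
  have : (θ w * m)⁻¹ = θ (m * w⁻¹) := by
    rw [mul_inv_rev, map_mul, map_eq_inv hm, map_inv]
  rw [← cs.length_inv, this, h.length_map]

theorem simple_conj_eq_of_isRightDescent (h : IsDiagramInvolution cs θ) (hNOF : NOF cs θ)
    {m : W} (hmι : m ∈ twistedIdentities θ) {c d : B}
    (hm : ∀ k ∈ ({c, d} : Set B), ¬ cs.IsRightDescent m k) {p : W}
    (hp : p ∈ parabolic cs {c, d}) (hpr : cs.IsReflection p) (hpm : θ p * m = m * p)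
    (hc : cs.IsRightDescent p c) : θ (cs.simple c) * m * cs.simple c = m := by
  have hmI := mem_twistedInvolutions h hmι
  have hcJ : c ∈ ({c, d} : Set B) := by simp
  have hcp := simple_mem_parabolic (cs := cs) hcJ
  have hθc := h.isReflection_map (cs.isReflection_simple c)
  have hlt : cs.length ((m * p)⁻¹ * θ (cs.simple c)) < cs.length (m * p)⁻¹ := by
    have h1 : ((m * p)⁻¹ * θ (cs.simple c))⁻¹ = θ (cs.simple c * p) * m := by
      rw [mul_inv_rev, inv_inv, ← map_inv, cs.inv_simple, ← hpm, map_mul, mul_assoc]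
    have h2 : (cs.simple c * p)⁻¹ = p * cs.simple c := by
      rw [mul_inv_rev, hpr.inv, cs.inv_simple]
    rw [← cs.length_inv, h1, length_map_mul h hmI, h2, length_mul_parabolic hm (mul_mem hp hcp),
      cs.length_inv, length_mul_parabolic hm hp]
    exact Nat.add_lt_add_left hc _
  rw [← reflCocycle_eq_one_iff cs hθc, mul_inv_rev, reflCocycle_mul, inv_inv] at hlt
  have h0 : reflCocycle cs m⁻¹ (θ (cs.simple c)) = 0 := by
    rw [← map_eq_inv hmI, h.reflCocycle_map (cs.isReflection_simple c),
      reflCocycle_simple_eq_zero_iff]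
    exact hm c hcJ
  rw [h0, zero_add] at hlt
  have hmem := mem_parabolic_of_reflCocycle_eq_one (inv_mem hp) hlt
  have hl : cs.length (m⁻¹ * θ (cs.simple c) * m) = 1 := by
    have h1 := length_mul_parabolic hm hmem
    have h2 := length_map_mul h hmI (cs.simple c)
    rw [cs.inv_simple, length_mul_parabolic hm hcp, cs.length_simple] at h2
    simp only [mul_assoc, mul_inv_cancel_left] at h1 h2 ⊢
    omega
  obtain ⟨e, he, heq⟩ := eq_simple_of_mem_parabolic hmem hl
  rw [mul_assoc, inv_mul_eq_iff_eq_mul] at heq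
  rcases he with rfl | rfl
  · rw [heq]
    simp
  · by_cases hce : cs.simple c = cs.simple e
    · rw [heq, hce]
      simp
    · exfalso
      apply hce
      have heq' : θ (cs.simple e) * m = m * cs.simple c := by
        have := congrArg (fun x => m * θ x * m) heq
        simpa [h.involutive (cs.simple c), map_eq_inv hmI, mul_assoc] using this.symm
      obtain ⟨k, hk | hk⟩ := dihedral_form_of_mem_parabolic hp
      · exact absurd (hk ▸ hpr) (not_isReflection_zpow c e k)
      have hpc : p * cs.simple c = cs.simple e * p := by
        have hσ : p = (cs.simple e * cs.simple c) ^ k * cs.simple e := by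
          let σ : W →* W := (MulAut.conj m⁻¹).toMonoidHom.comp θ.toMonoidHom
          have hσ : ∀ x x' : W, θ x * m = m * x' → σ x = x' := by
            intro x x' hx
            change m⁻¹ * θ x * m⁻¹⁻¹ = x'
            rw [inv_inv, mul_assoc, hx, inv_mul_cancel_left]
          rw [← hσ _ _ hpm, hk, map_mul, map_zpow, map_mul, hσ _ _ heq, hσ _ _ heq']
        conv_rhs => rw [hσ]
        rw [← mul_assoc, simple_mul_zpow_mul_simple, simple_mul_simple_zpow_inv, hk]
        simp
      obtain ⟨g, rfl⟩ := hmι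
      have hconj : ∀ x x' : W, θ x * (θ g⁻¹ * g) = θ g⁻¹ * g * x' →
          θ (g * x * g⁻¹) = g * x' * g⁻¹ := by
        intro x x' hx
        have := congrArg (fun z => θ g * z * g⁻¹) hx
        simpa [mul_assoc] using this
      have hcomm := commute_of_map_eq h hNOF (hpr.conj g) (hconj _ _ hpm)
        (p := g * cs.simple c * g⁻¹) (by
          rw [hconj _ _ heq]
          have : cs.simple e = p * cs.simple c * p := by
            rw [hpc, mul_assoc, hpr.mul_self, mul_one]
          rw [this]
          simp [mul_assoc])
      have hcomm' : cs.simple c * p = p * cs.simple c := by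
        exact mul_right_cancel (b := g⁻¹) (by simpa [mul_assoc] using hcomm)
      rw [hpc] at hcomm'
      exact mul_right_cancel hcomm'

theorem exists_isRightDescent_pair {c d : B} {p : W} (hp : p ∈ parabolic cs {c, d})
    (hpr : cs.IsReflection p) : cs.IsRightDescent p c ∨ cs.IsRightDescent p d := by
  have h1 : p ≠ 1 := by
    rintro rfl
    simpa using hpr.odd_length
  obtain ⟨k, rfl | rfl, hk⟩ := exists_isRightDescent_of_mem_parabolic hp h1
  · exact Or.inl hk
  · exact Or.inr hk

theorem eq_simple_of_simple_conj_ne (h : IsDiagramInvolution cs θ) (hNOF : NOF cs θ)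
    {m : W} (hmι : m ∈ twistedIdentities θ) {c d : B} (hmc : ¬ cs.IsRightDescent m c)
    (hmd : ¬ cs.IsRightDescent m d) (hd : θ (cs.simple d) * m * cs.simple d ≠ m) {p : W}
    (hp : p ∈ parabolic cs {c, d}) (hpr : cs.IsReflection p) (hpm : θ p * m = m * p) :
    p = cs.simple c ∧ θ (cs.simple c) * m * cs.simple c = m := by
  have hm : ∀ k ∈ ({c, d} : Set B), ¬ cs.IsRightDescent m k := by
    rintro k (rfl | rfl)
    · exact hmc
    · exact hmd
  have hnd : ∀ p' : W, p' ∈ parabolic cs {c, d} → cs.IsReflection p' → θ p' * m = m * p' →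
      cs.IsRightDescent p' c := by
    intro p' hp' hpr' hpm'
    refine (exists_isRightDescent_pair hp' hpr').resolve_right fun hdd => hd ?_
    rw [Set.pair_comm] at hm hp'
    exact simple_conj_eq_of_isRightDescent h hNOF hmι hm hp' hpr' hpm' hdd
  have hc := hnd p hp hpr hpm
  have hmc' := simple_conj_eq_of_isRightDescent h hNOF hmι hm hp hpr hpm hc
  refine ⟨?_, hmc'⟩
  by_contra hne
  have hcm := map_simple_mul_of_eq hmc'
  have hcp := simple_mem_parabolic (cs := cs) (J := {c, d}) (i := c) (by simp)
  have h1 := hnd (cs.simple c * p * cs.simple c) (mul_mem (mul_mem hcp hp) hcp)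
    (by simpa using hpr.conj (cs.simple c)) (by
      rw [map_mul, map_mul, mul_assoc, hcm, mul_assoc, ← mul_assoc (θ p), hpm, mul_assoc,
        ← mul_assoc, hcm]
      simp [mul_assoc])
  rw [← reflCocycle_simple_eq_one_iff] at h1 hc
  have h2 := reflCocycle_self cs (cs.isReflection_simple c)
  rw [reflCocycle_mul, mul_inv_cancel_right, reflCocycle_mul, h2, hc, ← add_assoc,
    CharTwo.add_self_eq_zero, zero_add, reflCocycle_simple] at h1
  have h3 : p * cs.simple c * p⁻¹ = cs.simple c := by
    by_contra h3
    rw [if_neg h3] at h1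
    exact zero_ne_one h1
  rw [reflCocycle_eq_zero_of_commute cs hpr (mul_inv_eq_iff_eq_mul.mp h3) (Ne.symm hne)] at hc
  exact zero_ne_one hc

end DihedralReflections

section Full

variable {cs : CoxeterSystem M W} {θ : W ≃* W}

theorem twistAct_bruhatLE (h : IsDiagramInvolution cs θ) {w : W}
    (hw : w ∈ twistedInvolutions θ) {i : B} (hi : cs.IsRightDescent w i) :
    bruhatLE cs (twistAct cs θ w i) w :=
  (bruhatLE_refl cs w).twistAct_le h hw hi

theorem bruhatLE_twistAct (h : IsDiagramInvolution cs θ) {w : W}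
    (hw : w ∈ twistedInvolutions θ) {i : B} (hi : ¬ cs.IsRightDescent w i) :
    bruhatLE cs w (twistAct cs θ w i) :=
  (bruhatLE_refl cs w).le_twistAct h hw hi

theorem IsFull.mono {u v v' : W} (hf : IsFull cs θ u v) (hv : bruhatLE cs v' v) :
    IsFull cs θ u v' :=
  fun w hw huw hwv => hf w hw huw (hwv.trans hv)

theorem IsFull.twistAct_of_isRightDescent (h : IsDiagramInvolution cs θ) {u v : W}
    (hv : v ∈ twistedInvolutions θ) (hf : IsFull cs θ u v) {i : B} (hiv : cs.IsRightDescent v i) :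
    IsFull cs θ (twistAct cs θ u i) (twistAct cs θ v i) := by
  intro w hw huw hwv
  have hwv' := hwv.trans (twistAct_bruhatLE h hv hiv)
  by_cases hi : cs.IsRightDescent w i
  · have := huw.twistAct_le h hw hi
    rw [twistAct_twistAct] at this
    exact hf w hw this hwv'
  · have hi' := (isRightDescent_twistAct h (θ := θ)).mpr hi
    have h1 := (huw.trans (bruhatLE_twistAct h hw hi)).twistAct_le h (twistAct_mem h hw i) hi'
    rw [twistAct_twistAct] at h1
    have h2 := hf _ (twistAct_mem h hw i) h1 (hwv'.twistAct_le h hv hiv)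
    have h3 := twistAct_mem_twistedIdentities h h2 hi'
    rwa [twistAct_twistAct] at h3

theorem length_twistAct_add_two (h : IsDiagramInvolution cs θ) {y : W}
    (hy : y ∈ twistedIdentities θ) {i : B} (hi : cs.IsRightDescent y i) :
    cs.length (twistAct cs θ y i) + 2 = cs.length y := by
  have hι := twistAct_mem_twistedIdentities h hy hi
  have hd : ¬ cs.IsRightDescent (twistAct cs θ y i) i := by rwa [isRightDescent_twistAct h, not_not]
  have hm : twistAct cs θ (twistAct cs θ y i) i ∈ twistedIdentities θ := by
    rwa [twistAct_twistAct]
  have hc := simple_conj_ne_of_twistAct_mem h hd hm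
  rw [← length_twistAct h (mem_twistedInvolutions h hι) hc hd, ← twistAct_of_ne hc,
    twistAct_twistAct]

/-- Along full intervals below `y`, being fixed by `w ↦ θ(s) w s` passes from `y` downwards. -/
def FixedDescends (cs : CoxeterSystem M W) (θ : W ≃* W) (y : W) : Prop :=
  ∀ u i, u ∈ twistedIdentities θ → bruhatLE cs u y → IsFull cs θ u y →
    ¬ cs.IsRightDescent u i → ¬ cs.IsRightDescent y i →
    θ (cs.simple i) * y * cs.simple i = y → θ (cs.simple i) * u * cs.simple i = u

theorem map_conj_mul_twistAct {y p : W} {a : B} (hp : θ p * y = y * p)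
    (ha : twistAct cs θ y a = θ (cs.simple a) * y * cs.simple a) :
    θ (cs.simple a * p * cs.simple a) * twistAct cs θ y a =
      twistAct cs θ y a * (cs.simple a * p * cs.simple a) := by
  have : θ (cs.simple a) * (θ (cs.simple a) * (y * cs.simple a)) = y * cs.simple a := by
    rw [← mul_assoc, map_simple_mul_self, one_mul]
  rw [ha, map_mul, map_mul]
  simp only [mul_assoc, this]
  rw [← mul_assoc (θ p), hp]
  simp [mul_assoc]

theorem conj_mem_parabolic_pair {a b : B} {p : W} (hp : p ∈ parabolic cs {a, b}) :
    cs.simple a * p * cs.simple a ∈ parabolic cs {b, a} := by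
  have ha := simple_mem_parabolic (cs := cs) (J := {a, b}) (i := a) (by simp)
  rw [Set.pair_comm]
  exact mul_mem (mul_mem ha hp) ha

theorem exists_simple_conj_eq_of_minimal (h : IsDiagramInvolution cs θ) (hNOF : NOF cs θ)
    {N : ℕ} (IH : ∀ y ∈ twistedIdentities θ, cs.length y < N → FixedDescends cs θ y)
    {n : W} (hn : n ∈ twistedIdentities θ) {y : W} (hy : y ∈ twistedIdentities θ)
    (hny : bruhatLE cs n y) (hf : IsFull cs θ n y) (hl : cs.length y < N) {a b : B}
    (hna : ¬ cs.IsRightDescent n a) (hnb : ¬ cs.IsRightDescent n b)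
    (hyb : ¬ cs.IsRightDescent y b) (hb : θ (cs.simple b) * y * cs.simple b ≠ y) {p : W}
    (hp : p ∈ parabolic cs {a, b}) (hpr : cs.IsReflection p) (hpy : θ p * y = y * p) :
    θ (cs.simple a) * n * cs.simple a = n ∨ θ (cs.simple b) * n * cs.simple b = n := by
  induction hk : cs.length y using Nat.strong_induction_on generalizing y a b p with
  | h k ih =>
  by_cases hya : cs.IsRightDescent y a
  · have hne := simple_conj_ne_of_isRightDescent h hy hya
    have hy' := twistAct_mem_twistedIdentities h hy hya
    have hlt := length_twistAct_add_two h hy hya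
    have hyI := mem_twistedInvolutions h hy
    have hya' : ¬ cs.IsRightDescent (twistAct cs θ y a) a := by
      rwa [isRightDescent_twistAct h, not_not]
    refine (ih _ (by omega) hy' (hny.le_twistAct h (mem_twistedInvolutions h hn) hna)
      (hf.mono (twistAct_bruhatLE h hyI hya)) (by omega) hnb hna hya' ?_
      (conj_mem_parabolic_pair hp) (by simpa using hpr.conj (cs.simple a))
      (map_conj_mul_twistAct hpy (twistAct_of_ne hne)) rfl).symm
    exact simple_conj_ne_of_twistAct_mem h hya' (by rwa [twistAct_twistAct])
  · obtain ⟨-, ha⟩ := eq_simple_of_simple_conj_ne h hNOF hy hya hyb hb hp hpr hpy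
    exact Or.inl (IH y hy hl n a hn hny hf hna hya ha)

theorem simple_conj_eq_of_chain (h : IsDiagramInvolution cs θ) (hNOF : NOF cs θ)
    {N : ℕ} (IH : ∀ y ∈ twistedIdentities θ, cs.length y < N → FixedDescends cs θ y)
    {u₀ : W} {s : B} (hu₀ : ¬ cs.IsRightDescent u₀ s)
    {u y : W} (hu : u ∈ twistedIdentities θ) (hy : y ∈ twistedIdentities θ)
    (huy : bruhatLE cs u y) (hf : IsFull cs θ u y) {a b : B}
    (hub : ¬ cs.IsRightDescent u b) (hyb : ¬ cs.IsRightDescent y b) {x : W}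
    (hp : x * cs.simple s * x⁻¹ ∈ parabolic cs {a, b})
    (hpy : θ (x * cs.simple s * x⁻¹) * y = y * (x * cs.simple s * x⁻¹))
    (hx : u₀ = θ x⁻¹ * u * x) (hlx : cs.length u + 2 * cs.length x ≤ cs.length u₀)
    (hstart : (u = u₀ ∧ b = s ∧ cs.IsRightDescent y a ∧ cs.length y ≤ N) ∨
      (θ (cs.simple b) * u * cs.simple b ≠ u ∧ θ (cs.simple b) * y * cs.simple b ≠ y ∧
        cs.length y < N)) :
    θ (cs.simple s) * u₀ * cs.simple s = u₀ := by
  induction hk : cs.length y using Nat.strong_induction_on generalizing y u a b x with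
  | h k ih =>
  have hpr := (cs.isReflection_simple s).conj x
  have hyI := mem_twistedInvolutions h hy
  have huI := mem_twistedInvolutions h hu
  by_cases hya : cs.IsRightDescent y a
  · have hyne := simple_conj_ne_of_isRightDescent h hy hya
    have hy' := twistAct_mem_twistedIdentities h hy hya
    have hlt := length_twistAct_add_two h hy hya
    have hya' : ¬ cs.IsRightDescent (twistAct cs θ y a) a := by
      rwa [isRightDescent_twistAct h, not_not]
    have hyne' := simple_conj_ne_of_twistAct_mem h hya' (by rwa [twistAct_twistAct])
    have hlN : cs.length (twistAct cs θ y a) < N := by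
      rcases hstart with ⟨-, -, -, hl⟩ | ⟨-, -, hl⟩ <;> omega
    have hp' := conj_mem_parabolic_pair hp
    have hpy' := map_conj_mul_twistAct hpy (twistAct_of_ne hyne)
    by_cases hua : cs.IsRightDescent u a
    · have hune := simple_conj_ne_of_isRightDescent h hu hua
      have hu' := twistAct_mem_twistedIdentities h hu hua
      have hlu := length_twistAct_add_two h hu hua
      have hua' : ¬ cs.IsRightDescent (twistAct cs θ u a) a := by
        rwa [isRightDescent_twistAct h, not_not]
      have hune' := simple_conj_ne_of_twistAct_mem h hua' (by rwa [twistAct_twistAct])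
      have hconj : cs.simple a * (x * cs.simple s * x⁻¹) * cs.simple a =
          cs.simple a * x * cs.simple s * (cs.simple a * x)⁻¹ := by
        simp [mul_assoc]
      rw [hconj] at hp' hpy'
      refine ih _ (by omega) hu' hy' (huy.twistAct_le_twistAct h huI hyI hua hya)
        (hf.twistAct_of_isRightDescent h hyI hya) hua' hya' hp' hpy' ?_ ?_
        (Or.inr ⟨hune', hyne', hlN⟩) rfl
      · have : u = θ (cs.simple a) * twistAct cs θ u a * cs.simple a := by
          rw [← twistAct_of_ne hune', twistAct_twistAct]
        rw [hx]
        conv_lhs => rw [this]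
        simp [mul_assoc]
      · have := cs.length_mul_le (cs.simple a) x
        rw [cs.length_simple] at this
        omega
    · have hna : θ (cs.simple a) * u * cs.simple a ≠ u := by
        refine simple_conj_ne_of_twistAct_mem h hua (hf _ (twistAct_mem h huI a) ?_ ?_)
        · exact bruhatLE_twistAct h huI hua
        · exact huy.twistAct_le h hyI hya
      have := exists_simple_conj_eq_of_minimal h hNOF IH hu hy'
        (huy.le_twistAct h huI hua) (hf.mono (twistAct_bruhatLE h hyI hya)) hlN hub hua hya'
        hyne' hp' (by simpa using hpr.conj (cs.simple a)) hpy'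
      have hb := this.resolve_right hna
      rcases hstart with ⟨rfl, rfl, -, -⟩ | ⟨hb', -, -⟩
      · exact hb
      · exact absurd hb hb'
  · obtain ⟨hyb', hlN⟩ : θ (cs.simple b) * y * cs.simple b ≠ y ∧ cs.length y < N := by
      rcases hstart with ⟨-, -, hya', -⟩ | ⟨-, h1, h2⟩
      · exact absurd hya' hya
      · exact ⟨h1, h2⟩
    obtain ⟨hpa, ha⟩ := eq_simple_of_simple_conj_ne h hNOF hy hya hyb hyb' hp hpr hpy
    rw [mul_inv_eq_iff_eq_mul] at hpa
    have hxa : x⁻¹ * cs.simple a = cs.simple s * x⁻¹ := by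
      have := congrArg (·⁻¹) hpa
      simpa using this.symm
    have hua : ¬ cs.IsRightDescent u a := by
      intro hua
      have hune := simple_conj_ne_of_isRightDescent h hu hua
      have hlu := length_twistAct_add_two h hu hua
      have huv : u * cs.simple a = θ (cs.simple a) * twistAct cs θ u a := by
        rw [twistAct_of_ne hune, ← mul_assoc, ← mul_assoc, map_simple_mul_self, one_mul]
      have hus : u₀ * cs.simple s = θ (cs.simple s) * (θ x⁻¹ * twistAct cs θ u a * x) := by
        rw [hx, mul_assoc _ x, hpa, ← mul_assoc, mul_assoc _ u, huv, ← mul_assoc, ← mul_assoc,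
          ← map_mul, hxa, map_mul]
        simp only [mul_assoc]
      apply hu₀
      have h1 := cs.length_mul_le (θ (cs.simple s)) (θ x⁻¹ * twistAct cs θ u a * x)
      have h2 := cs.length_mul_le (θ x⁻¹ * twistAct cs θ u a) x
      have h3 := cs.length_mul_le (θ x⁻¹) (twistAct cs θ u a)
      rw [h.length_map, cs.length_simple] at h1
      rw [h.length_map, cs.length_inv] at h3
      rw [CoxeterSystem.IsRightDescent, hus]
      omega
    have huu := IH y hy hlN u a hu huy hf hua hya ha
    rw [hx, ← mul_assoc, ← mul_assoc, ← map_mul, ← hxa, mul_assoc _ x, hpa, map_mul]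
    conv_rhs => rw [← huu]
    simp only [mul_assoc]

theorem fixedDescends (h : IsDiagramInvolution cs θ) (hNOF : NOF cs θ) {y : W}
    (hy : y ∈ twistedIdentities θ) : FixedDescends cs θ y := by
  induction hk : cs.length y using Nat.strong_induction_on generalizing y with
  | h k ih =>
  subst hk
  intro u i hu huy hf hui hyi hi
  rcases eq_or_ne y 1 with rfl | hy1
  · rcases huy.eq_or_length_lt with rfl | hlt
    · exact hi
    · simp at hlt
  obtain ⟨a, ha⟩ := cs.exists_rightDescent_of_ne_one hy1
  have hp : (1 : W) * cs.simple i * 1⁻¹ = cs.simple i := by simp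
  refine simple_conj_eq_of_chain h hNOF (N := cs.length y) (fun z hz hlt => ih _ hlt hz rfl)
    hui hu hy huy hf (a := a) (b := i) (x := 1) hui hyi ?_ ?_ (by simp) (by simp)
    (Or.inl ⟨rfl, rfl, ha, le_rfl⟩)
  · rw [hp]
    exact simple_mem_parabolic (by simp)
  · rw [hp]
    exact map_simple_mul_of_eq hi

end Full

theorem statement13 [Finite B] (cs : CoxeterSystem M W) (θ : W ≃* W)
    (hθ : Function.Involutive θ)
    (hθS : ∀ i : B, ∃ j : B, θ (cs.simple i) = cs.simple j)
    (hNOF : NOF cs θ)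
    (u v : W) (hu : u ∈ twistedIdentities θ) (hv : v ∈ twistedIdentities θ)
    (huv : bruhatLE cs u v) (hfull : IsFull cs θ u v)
    (i : B) (hiv : ¬ cs.IsRightDescent v i) (hiu : ¬ cs.IsRightDescent u i) :
    θ (cs.simple i) * u * cs.simple i = u ∨
      (twistAct cs θ v i ∈ twistedIdentities θ ∧
        IsFull cs θ u (twistAct cs θ v i)) := by
  have h : IsDiagramInvolution cs θ := ⟨hθ, hθS⟩
  have huI := mem_twistedInvolutions h hu
  have hvI := mem_twistedInvolutions h hv
  by_contra hcon
  push Not at hcon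
  obtain ⟨hne, hcon⟩ := hcon
  have hvi := (isRightDescent_twistAct h (θ := θ)).mpr hiv
  have hmem : ∀ w ∈ twistedInvolutions θ, bruhatLE cs u w → bruhatLE cs w (twistAct cs θ v i) →
      w ∈ twistedIdentities θ := by
    intro w hw huw hwv
    by_cases hi : cs.IsRightDescent w i
    · have hwv' := hwv.twistAct_le_twistAct h hw (twistAct_mem h hvI i) hi hvi
      have huw' := huw.le_twistAct h huI hiu
      rw [twistAct_twistAct] at hwv'
      have hι := hfull _ (twistAct_mem h hw i) huw' hwv'
      have hi' : ¬ cs.IsRightDescent (twistAct cs θ w i) i := by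
        rwa [isRightDescent_twistAct h, not_not]
      by_cases hc : θ (cs.simple i) * twistAct cs θ w i * cs.simple i = twistAct cs θ w i
      · exact absurd (fixedDescends h hNOF hι u i hu huw' (hfull.mono hwv') hiu hi' hc) hne
      · rw [← twistAct_twistAct (cs := cs) w i, twistAct_of_ne hc]
        exact simple_conj_mem_twistedIdentities hι i
    · have := hwv.le_twistAct h hw hi
      rw [twistAct_twistAct] at this
      exact hfull w hw huw this
  exact hcon (hmem _ (twistAct_mem h hvI i) (huv.le_twistAct h huI hiu) (bruhatLE_refl cs _)) hmem

end TwistedIdentitiesPaper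
end

section
/- Suppose θ has the NOF property. Let u,v ∈ ι(θ) with u < v in the Bruhat order, and let s ∈ S be such that v·s̲ = vs (i.e., θ(s)vs = v). If u·s̲ = θ(s)us and ℓ(u·s̲) > ℓ(u), then u·s̲ < v. -/
namespace CoxeterSystem

variable {B : Type*} {W : Type*} [Group W] {M : CoxeterMatrix B} (cs : CoxeterSystem M W)

open scoped Classical in
/-- The action of a simple reflection on `W × ZMod 2`, which on pairs whose first entry is a
reflection models the action on the root system. -/
noncomputable def signedConj (i : B) : Equiv.Perm (W × ZMod 2) :=
  Function.Involutive.toPerm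
    (fun p ↦ (cs.simple i * p.1 * cs.simple i, p.2 + if p.1 = cs.simple i then 1 else 0)) <| by
      rintro ⟨t, e⟩
      have h : cs.simple i * t * cs.simple i = cs.simple i ↔ t = cs.simple i := by
        rw [mul_assoc, mul_eq_left, mul_eq_one_iff_eq_inv, cs.inv_simple]
      simp only [h, Prod.mk.injEq]
      refine ⟨by simp [mul_assoc], ?_⟩
      split_ifs
      · rw [add_assoc, CharTwo.add_self_eq_zero, add_zero]
      · simp

open scoped Classical in
theorem signedConj_apply (i : B) (p : W × ZMod 2) :
    cs.signedConj i p =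
      (cs.simple i * p.1 * cs.simple i, p.2 + if p.1 = cs.simple i then 1 else 0) := rfl

open scoped Classical in
theorem signedConj_mul_pow_apply (i j : B) (n : ℕ) (t : W) (e : ZMod 2) :
    ((cs.signedConj i * cs.signedConj j) ^ n) (t, e) =
      ((cs.simple i * cs.simple j) ^ n * t * ((cs.simple i * cs.simple j) ^ n)⁻¹,
        e + ∑ k ∈ Finset.range (2 * n),
          if t = ((cs.simple i * cs.simple j) ^ k)⁻¹ * cs.simple j then 1 else 0) := by
  induction n with
  | zero => simp
  | succ n ih =>
    set r := cs.simple i * cs.simple j with hr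
    have hjr : ∀ k : ℕ, cs.simple j * r ^ k = (r ^ k)⁻¹ * cs.simple j := by
      intro k
      induction k with
      | zero => simp
      | succ k ihk =>
        rw [pow_succ, ← mul_assoc, ihk, ← pow_succ, pow_succ', mul_inv_rev, hr]
        simp [mul_assoc]
    have h1 : r ^ n * t * (r ^ n)⁻¹ = cs.simple j ↔ t = (r ^ (2 * n))⁻¹ * cs.simple j := by
      rw [mul_inv_eq_iff_eq_mul, hjr, ← eq_inv_mul_iff_mul_eq, ← mul_assoc, ← mul_inv_rev,
        ← pow_add, two_mul]
    have h2 : cs.simple j * (r ^ n * t * (r ^ n)⁻¹) * cs.simple j = cs.simple i ↔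
        t = (r ^ (2 * n + 1))⁻¹ * cs.simple j := by
      have : (r ^ (2 * n + 1))⁻¹ * cs.simple j =
          (r ^ n)⁻¹ * (cs.simple j * cs.simple i * cs.simple j) * r ^ n := by
        have hji : cs.simple j * cs.simple i = r⁻¹ := by simp [hr]
        rw [mul_assoc _ _ (r ^ n), mul_assoc _ _ (r ^ n), hjr, hji, pow_succ', two_mul, pow_add]
        simp only [mul_inv_rev, mul_assoc]
        rw [← mul_assoc (r ^ n)⁻¹ r⁻¹, ← mul_assoc r⁻¹ (r ^ n)⁻¹, ← mul_inv_rev, ← mul_inv_rev,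
          ← pow_succ, ← pow_succ']
      rw [this]
      constructor
      · intro h
        rw [← h]
        simp [mul_assoc]
      · rintro rfl
        simp [mul_assoc]
    rw [pow_succ', Equiv.Perm.mul_apply, ih, Equiv.Perm.mul_apply, signedConj_apply,
      signedConj_apply]
    simp only [h1, h2, mul_add, mul_one, Finset.sum_range_succ, Prod.mk.injEq]
    refine ⟨?_, by ring⟩
    rw [pow_succ', mul_inv_rev]
    simp [hr, mul_assoc]

theorem isLiftable_signedConj : M.IsLiftable cs.signedConj := by
  classical
  intro i j
  ext1 ⟨t, e⟩
  rw [signedConj_mul_pow_apply, two_mul, Finset.sum_range_add]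
  simp only [pow_add, cs.simple_mul_simple_pow, one_mul, inv_one, mul_one]
  rw [CharTwo.add_self_eq_zero, add_zero, Equiv.Perm.one_apply]

/-- The action of `W` on `W × ZMod 2` extending `signedConj`. -/
noncomputable def signedConjHom : W →* Equiv.Perm (W × ZMod 2) :=
  cs.lift ⟨cs.signedConj, cs.isLiftable_signedConj⟩

/-- For a reflection `t`, this is `1` if `t` is a right inversion of `w` and `0` otherwise. -/
noncomputable def inversionSign (w t : W) : ZMod 2 := (cs.signedConjHom w (t, 0)).2

open scoped Classical in
theorem signedConjHom_apply (w t : W) (e : ZMod 2) :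
    cs.signedConjHom w (t, e) = (w * t * w⁻¹, e + cs.inversionSign w t) := by
  have key : ∀ w : W, ∀ t e, cs.signedConjHom w (t, e) =
      (w * t * w⁻¹, e + (cs.signedConjHom w (t, 0)).2) := by
    intro w
    induction w using cs.simple_induction_left with
    | one => simp
    | mul_simple_left w i ih =>
      intro t e
      rw [map_mul, Equiv.Perm.mul_apply, Equiv.Perm.mul_apply, ih t e, ih t 0]
      simp only [signedConjHom, lift_apply_simple, signedConj_apply, Prod.mk.injEq]
      exact ⟨by simp [mul_assoc], by ring⟩
  exact key w t e

open scoped Classical in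
theorem inversionSign_simple (i : B) (t : W) :
    cs.inversionSign (cs.simple i) t = if t = cs.simple i then 1 else 0 := by
  simp [inversionSign, signedConjHom, signedConj_apply]

theorem inversionSign_one (t : W) : cs.inversionSign 1 t = 0 := by
  simp [inversionSign]

theorem inversionSign_mul (x y t : W) :
    cs.inversionSign (x * y) t =
      cs.inversionSign y t + cs.inversionSign x (y * t * y⁻¹) := by
  rw [inversionSign, map_mul, Equiv.Perm.mul_apply, signedConjHom_apply, signedConjHom_apply]
  simp

theorem inversionSign_inv (w t : W) :
    cs.inversionSign w⁻¹ (w * t * w⁻¹) = cs.inversionSign w t := by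
  have h := cs.inversionSign_mul w⁻¹ w t
  rw [inv_mul_cancel, inversionSign_one] at h
  exact (CharTwo.add_eq_zero.mp h.symm).symm

theorem inversionSign_self {t : W} (ht : cs.IsReflection t) : cs.inversionSign t t = 1 := by
  classical
  obtain ⟨w, i, rfl⟩ := ht
  have h : w⁻¹ * (w * cs.simple i * w⁻¹) * w⁻¹⁻¹ = cs.simple i := by group
  rw [inversionSign_mul, inversionSign_mul, h, inversionSign_inv, inversionSign_simple]
  simp only [cs.inv_simple, cs.simple_mul_simple_self, one_mul, if_true]
  rw [add_comm (1 : ZMod 2), ← add_assoc, CharTwo.add_self_eq_zero, zero_add]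

theorem mem_rightInvSeq_of_inversionSign (ω : List B) {t : W}
    (h : cs.inversionSign (cs.wordProd ω) t ≠ 0) : t ∈ cs.rightInvSeq ω := by
  classical
  induction ω with
  | nil => simp [inversionSign_one] at h
  | cons i ω ih =>
    rw [wordProd_cons, inversionSign_mul, inversionSign_simple] at h
    rw [rightInvSeq, List.mem_cons]
    by_cases h1 : cs.inversionSign (cs.wordProd ω) t = 0
    · left
      rw [h1, zero_add] at h
      have h2 : cs.wordProd ω * t * (cs.wordProd ω)⁻¹ = cs.simple i := by
        by_contra h2
        exact h (if_neg h2)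
      rw [← h2]
      group
    · exact Or.inr (ih h1)

theorem length_mul_lt_of_inversionSign {w t : W} (h : cs.inversionSign w t ≠ 0) :
    cs.length (w * t) < cs.length w := by
  obtain ⟨ω, hω, rfl⟩ := cs.exists_isReduced w
  exact (cs.isRightInversion_of_mem_rightInvSeq hω (cs.mem_rightInvSeq_of_inversionSign ω h)).2

theorem length_lt_mul_of_inversionSign {w t : W} (ht : cs.IsReflection t)
    (h : cs.inversionSign w t = 0) : cs.length w < cs.length (w * t) := by
  have h1 : cs.inversionSign (w * t) t ≠ 0 := by
    rw [inversionSign_mul, cs.inversionSign_self ht, ht.inv, ht.mul_self, one_mul, h]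
    decide
  simpa [mul_assoc, ht.mul_self] using cs.length_mul_lt_of_inversionSign h1

theorem inversionSign_eq_zero_iff {w t : W} (ht : cs.IsReflection t) :
    cs.inversionSign w t = 0 ↔ cs.length w < cs.length (w * t) :=
  ⟨cs.length_lt_mul_of_inversionSign ht, fun h ↦ by
    by_contra h1
    exact (cs.length_mul_lt_of_inversionSign h1).asymm h⟩

theorem inversionSign_ne_zero_iff {w t : W} (ht : cs.IsReflection t) :
    cs.inversionSign w t ≠ 0 ↔ cs.length (w * t) < cs.length w :=
  ⟨cs.length_mul_lt_of_inversionSign, fun h h1 ↦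
    (cs.length_lt_mul_of_inversionSign ht h1).asymm h⟩

/-- The strong exchange property, for arbitrary words. -/
theorem exists_eraseIdx_of_length_mul_lt (ω : List B) {t : W} (ht : cs.IsReflection t)
    (h : cs.length (cs.wordProd ω * t) < cs.length (cs.wordProd ω)) :
    ∃ j < ω.length, cs.wordProd ω * t = cs.wordProd (ω.eraseIdx j) := by
  have hmem := cs.mem_rightInvSeq_of_inversionSign ω ((cs.inversionSign_ne_zero_iff ht).mpr h)
  obtain ⟨j, hj, rfl⟩ := List.mem_iff_getElem.mp hmem
  refine ⟨j, by simpa using hj, ?_⟩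
  rw [← List.getD_eq_getElem _ 1 hj, wordProd_mul_getD_rightInvSeq]

/-- The deletion property. -/
theorem exists_isReduced_sublist (ω : List B) :
    ∃ ω' : List B, ω'.Sublist ω ∧ cs.IsReduced ω' ∧ cs.wordProd ω' = cs.wordProd ω := by
  induction hn : ω.length using Nat.strong_induction_on generalizing ω with
  | _ n ih =>
    by_cases hred : cs.IsReduced ω
    · exact ⟨ω, List.Sublist.refl _, hred, rfl⟩
    rcases List.eq_nil_or_concat ω with rfl | ⟨ω₁, i, rfl⟩
    · exact absurd (by simp [IsReduced]) hred
    simp only [List.concat_eq_append, List.length_append, List.length_singleton] at hn hred ⊢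
    obtain ⟨ω₂, hsub, hred₂, hprod⟩ := ih ω₁.length (by omega) ω₁ rfl
    rcases cs.length_mul_simple (cs.wordProd ω₂) i with h | h
    · refine ⟨ω₂ ++ [i], hsub.append (List.Sublist.refl _), ?_, by simp [wordProd_append, hprod]⟩
      rw [IsReduced, wordProd_append, wordProd_singleton, h, hred₂.eq]
      simp
    · obtain ⟨j, hj, he⟩ := cs.exists_eraseIdx_of_length_mul_lt ω₂ (cs.isReflection_simple i)
        (by omega)
      refine ⟨ω₂.eraseIdx j, ?_, ?_, ?_⟩
      · exact ((List.eraseIdx_sublist _ _).trans hsub).trans (List.sublist_append_left _ _)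
      · rw [IsReduced, ← he]
        have := List.length_eraseIdx_add_one hj
        have := hred₂.eq
        omega
      · rw [← he, wordProd_append, wordProd_singleton, hprod]

theorem isRightDescent_iff_inversionSign {w : W} {i : B} :
    cs.IsRightDescent w i ↔ cs.inversionSign w (cs.simple i) ≠ 0 :=
  (cs.inversionSign_ne_zero_iff (cs.isReflection_simple i)).symm

theorem isRightDescent_simple_mul_iff {w : W} {i j : B}
    (h : cs.simple i * w ≠ w * cs.simple j) :
    cs.IsRightDescent (cs.simple i * w) j ↔ cs.IsRightDescent w j := by
  classical
  have h1 : w * cs.simple j * w⁻¹ ≠ cs.simple i := fun h1 ↦ h (by simp [← h1])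
  rw [isRightDescent_iff_inversionSign, isRightDescent_iff_inversionSign, inversionSign_mul,
    inversionSign_simple, if_neg h1, add_zero]

theorem length_simple_mul_mul_simple_of_descents {w : W} {i j : B} (hi : cs.IsLeftDescent w i)
    (hj : cs.IsRightDescent w j) (h : cs.simple i * w ≠ w * cs.simple j) :
    cs.length (cs.simple i * w * cs.simple j) + 2 = cs.length w := by
  have h1 := cs.isRightDescent_iff.mp ((cs.isRightDescent_simple_mul_iff h).mpr hj)
  have h2 := cs.isLeftDescent_iff.mp hi
  omega

theorem length_simple_mul_mul_simple_of_ascents {w : W} {i j : B} (hi : ¬cs.IsLeftDescent w i)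
    (hj : ¬cs.IsRightDescent w j) (h : cs.simple i * w ≠ w * cs.simple j) :
    cs.length (cs.simple i * w * cs.simple j) = cs.length w + 2 := by
  have h1 := cs.not_isRightDescent_iff.mp (mt (cs.isRightDescent_simple_mul_iff h).mp hj)
  have h2 := cs.not_isLeftDescent_iff.mp hi
  omega

/-! ### Parabolic subgroups -/

/-- The standard parabolic subgroup generated by the simple reflections indexed by `J`. -/
def parabolic (J : Set B) : Subgroup W := Subgroup.closure (cs.simple '' J)

variable {J J' : Set B}

theorem simple_mem_parabolic {i : B} (hi : i ∈ J) : cs.simple i ∈ cs.parabolic J :=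
  Subgroup.subset_closure ⟨i, hi, rfl⟩

theorem wordProd_mem_parabolic {ω : List B} (hω : ∀ i ∈ ω, i ∈ J) :
    cs.wordProd ω ∈ cs.parabolic J := by
  induction ω with
  | nil => simp [one_mem]
  | cons i ω ih =>
    rw [wordProd_cons]
    exact mul_mem (cs.simple_mem_parabolic (hω i (by simp))) (ih fun k hk ↦ hω k (by simp [hk]))

theorem exists_isReduced_of_mem_parabolic {g : W} (hg : g ∈ cs.parabolic J) :
    ∃ ω : List B, (∀ i ∈ ω, i ∈ J) ∧ cs.IsReduced ω ∧ cs.wordProd ω = g := by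
  have h : ∃ ω : List B, (∀ i ∈ ω, i ∈ J) ∧ cs.wordProd ω = g := by
    induction hg using Subgroup.closure_induction with
    | mem x hx =>
      obtain ⟨i, hi, rfl⟩ := hx
      exact ⟨[i], by simpa using hi, by simp⟩
    | one => exact ⟨[], by simp, by simp⟩
    | mul x y _ _ hx hy =>
      obtain ⟨ω, hω, rfl⟩ := hx
      obtain ⟨ω', hω', rfl⟩ := hy
      refine ⟨ω ++ ω', fun i hi ↦ ?_, cs.wordProd_append ω ω'⟩
      exact (List.mem_append.mp hi).elim (hω i) (hω' i)
    | inv x _ hx =>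
      obtain ⟨ω, hω, rfl⟩ := hx
      exact ⟨ω.reverse, by simpa using hω, cs.wordProd_reverse ω⟩
  obtain ⟨ω, hω, rfl⟩ := h
  obtain ⟨ω', hsub, hred, hprod⟩ := cs.exists_isReduced_sublist ω
  exact ⟨ω', fun i hi ↦ hω i (hsub.subset hi), hred, hprod⟩

theorem exists_simple_of_mem_parabolic {g : W} (hg : g ∈ cs.parabolic J)
    (h : cs.length g = 1) : ∃ i ∈ J, g = cs.simple i := by
  obtain ⟨ω, hω, hred, rfl⟩ := cs.exists_isReduced_of_mem_parabolic hg
  rw [hred.eq, List.length_eq_one_iff] at h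
  obtain ⟨i, rfl⟩ := h
  exact ⟨i, by simpa using hω, by simp⟩

theorem exists_rightDescent_of_mem_parabolic {g : W} (hg : g ∈ cs.parabolic J) (h : g ≠ 1) :
    ∃ i ∈ J, cs.IsRightDescent g i := by
  obtain ⟨ω, hω, hred, rfl⟩ := cs.exists_isReduced_of_mem_parabolic hg
  rcases List.eq_nil_or_concat ω with rfl | ⟨ω', i, rfl⟩
  · exact absurd (by simp) h
  refine ⟨i, hω i (by simp), ?_⟩
  have h1 := hred.eq
  have h2 := cs.length_wordProd_le ω'
  rw [IsRightDescent, h1, wordProd_concat]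
  simp only [simple_mul_simple_cancel_right, List.length_concat]
  omega

/-- If `x` has no right descent in `J` then lengths add up in `x * g` for `g` in `W_J`. -/
theorem length_mul_of_mem_parabolic {x g : W} (hx : ∀ i ∈ J, ¬cs.IsRightDescent x i)
    (hg : g ∈ cs.parabolic J) : cs.length (x * g) = cs.length x + cs.length g := by
  have additive : ∀ x₀ : W, (∀ t ∈ cs.parabolic J, cs.IsReflection t →
      cs.inversionSign x₀ t = 0) →
      ∀ g ∈ cs.parabolic J, cs.length (x₀ * g) = cs.length x₀ + cs.length g := by
    intro x₀ hx₀ g hg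
    obtain ⟨ω, hω, hred, rfl⟩ := cs.exists_isReduced_of_mem_parabolic hg
    clear hg
    induction ω using List.reverseRecOn with
    | nil => simp
    | append_singleton ω i ih =>
      have hω' : ∀ k ∈ ω, k ∈ J := fun k hk ↦ hω k (by simp [hk])
      have hred' : cs.IsReduced ω := by simpa using hred.take ω.length
      have hi : i ∈ J := hω i (by simp)
      have h1 := ih hω' hred'
      have h2 : cs.length (cs.wordProd ω * cs.simple i) = cs.length (cs.wordProd ω) + 1 := by
        rw [← wordProd_singleton, ← wordProd_append, hred.eq, hred'.eq]
        simp
      have h3 : cs.inversionSign (x₀ * cs.wordProd ω) (cs.simple i) = 0 := by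
        rw [inversionSign_mul, hx₀, add_zero,
          cs.inversionSign_eq_zero_iff (cs.isReflection_simple i)]
        · omega
        · exact mul_mem (mul_mem (cs.wordProd_mem_parabolic hω') (cs.simple_mem_parabolic hi))
            (inv_mem (cs.wordProd_mem_parabolic hω'))
        · exact (cs.isReflection_simple i).conj _
      rw [cs.inversionSign_eq_zero_iff (cs.isReflection_simple i)] at h3
      have h4 := cs.length_mul_simple (x₀ * cs.wordProd ω) i
      rw [wordProd_append, wordProd_singleton, h2, ← mul_assoc]
      omega
  obtain ⟨h, hh, hmin⟩ : ∃ h ∈ cs.parabolic J, ∀ k ∈ cs.parabolic J,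
      cs.length (x * h) ≤ cs.length (x * k) := by
    obtain ⟨h, hmin⟩ := exists_minimalFor_of_wellFoundedLT
      (fun h ↦ h ∈ cs.parabolic J) (fun h ↦ cs.length (x * h)) ⟨1, one_mem _⟩
    exact ⟨h, hmin.1, fun k hk ↦ not_lt.mp (hmin.not_lt hk)⟩
  have hadd := additive (x * h) fun t ht hrefl ↦ by
    rw [cs.inversionSign_eq_zero_iff hrefl]
    have h1 := hmin (h * t) (mul_mem hh ht)
    have h2 := hrefl.length_mul_left_ne (x * h)
    rw [← mul_assoc] at h1
    omega
  have h1 : h = 1 := by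
    by_contra hne
    obtain ⟨i, hi, hdesc⟩ := cs.exists_rightDescent_of_mem_parabolic (inv_mem hh)
      (inv_ne_one.mpr hne)
    apply hx i hi
    have h2 := hadd (h⁻¹ * cs.simple i) (mul_mem (inv_mem hh) (cs.simple_mem_parabolic hi))
    have h3 := hadd h⁻¹ (inv_mem hh)
    rw [mul_inv_cancel_right] at h3
    rw [← mul_assoc, mul_inv_cancel_right] at h2
    rw [IsRightDescent] at hdesc ⊢
    omega
  simpa [h1] using hadd g hg

theorem length_mul_of_mem_parabolic' {x g : W} (hx : ∀ i ∈ J, ¬cs.IsLeftDescent x i)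
    (hg : g ∈ cs.parabolic J) : cs.length (g * x) = cs.length g + cs.length x := by
  have h := cs.length_mul_of_mem_parabolic (x := x⁻¹) (J := J)
    (fun i hi ↦ by simpa [cs.isRightDescent_inv_iff] using hx i hi) (inv_mem hg)
  rw [← mul_inv_rev, length_inv, length_inv, length_inv] at h
  omega

/-- If `g * x' = x * h` where `g ∈ W_{J'}`, `h ∈ W_J`, and `x`, `x'` have no descents on the
relevant sides, then every letter of a reduced word of `g` is sent into `J` by conjugation
with `x⁻¹`. -/
theorem exists_simple_mul_eq_mul_simple {x x' : W} (hx : ∀ i ∈ J, ¬cs.IsRightDescent x i)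
    (hxl : ∀ i ∈ J', ¬cs.IsLeftDescent x i) (hx' : ∀ i ∈ J', ¬cs.IsLeftDescent x' i)
    {ω : List B} (hω : ∀ i ∈ ω, i ∈ J') (hred : cs.IsReduced ω) {h : W}
    (hh : h ∈ cs.parabolic J) (heq : cs.wordProd ω * x' = x * h) :
    ∀ i ∈ ω, ∃ j ∈ J, cs.simple i * x = x * cs.simple j := by
  induction ω generalizing h with
  | nil => simp
  | cons i ω ih =>
    have hω' : ∀ k ∈ ω, k ∈ J' := fun k hk ↦ hω k (by simp [hk])
    have hred' : cs.IsReduced ω := by simpa using hred.drop 1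
    have hi : i ∈ J' := hω i (by simp)
    have h1 := cs.length_mul_of_mem_parabolic' hx' (cs.wordProd_mem_parabolic hω)
    have h2 := cs.length_mul_of_mem_parabolic' hx' (cs.wordProd_mem_parabolic hω')
    have h3 : cs.inversionSign (h⁻¹ * x⁻¹) (cs.simple i) ≠ 0 := by
      rw [← isRightDescent_iff_inversionSign, ← mul_inv_rev, isRightDescent_inv_iff,
        IsLeftDescent, ← heq, h1, hred.eq]
      rw [hred'.eq] at h2
      rw [wordProd_cons]
      simp only [mul_assoc, simple_mul_simple_cancel_left, h2, List.length_cons]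
      omega
    have h4 : cs.inversionSign x⁻¹ (cs.simple i) = 0 := by
      by_contra h4
      exact hxl i hi (cs.isRightDescent_inv_iff.mp (cs.isRightDescent_iff_inversionSign.mpr h4))
    rw [inversionSign_mul, h4, zero_add, inv_inv] at h3
    set t := x⁻¹ * cs.simple i * x with ht
    have htmem : t ∈ cs.parabolic J := by
      obtain ⟨υ, hυ, hυred, hυprod⟩ := cs.exists_isReduced_of_mem_parabolic (inv_mem hh)
      have hrefl : cs.IsReflection t := by
        simpa using (cs.isReflection_simple i).conj x⁻¹
      have hlt := cs.length_mul_lt_of_inversionSign h3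
      rw [← hυprod] at hlt
      obtain ⟨k, _, hk⟩ := cs.exists_eraseIdx_of_length_mul_lt υ hrefl hlt
      have : t = (cs.wordProd υ)⁻¹ * cs.wordProd (υ.eraseIdx k) := by rw [← hk]; group
      rw [this]
      exact mul_mem (inv_mem (cs.wordProd_mem_parabolic hυ))
        (cs.wordProd_mem_parabolic fun a ha ↦ hυ a ((List.eraseIdx_sublist _ _).subset ha))
    have hxt : cs.simple i * x = x * t := by rw [ht]; group
    have hlen : cs.length t = 1 := by
      have h5 := cs.length_mul_of_mem_parabolic hx htmem
      have h6 := cs.not_isLeftDescent_iff.mp (hxl i hi)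
      rw [← hxt] at h5
      omega
    obtain ⟨j, hj, htj⟩ := cs.exists_simple_of_mem_parabolic htmem hlen
    intro k hk
    rcases List.mem_cons.mp hk with rfl | hk
    · exact ⟨j, hj, htj ▸ hxt⟩
    · refine ih hω' hred' (mul_mem htmem hh) ?_ k hk
      rw [← mul_assoc, ← hxt, mul_assoc, ← heq, wordProd_cons, mul_assoc,
        simple_mul_simple_cancel_left]

/-! ### Reflections -/

theorem IsReflection.isLeftDescent_iff {cs : CoxeterSystem M W} {t : W} (ht : cs.IsReflection t)
    {i : B} : cs.IsLeftDescent t i ↔ cs.IsRightDescent t i := by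
  rw [← cs.isRightDescent_inv_iff, ht.inv]

theorem IsReflection.simple_conj {cs : CoxeterSystem M W} {t : W} (ht : cs.IsReflection t)
    (i : B) : cs.IsReflection (cs.simple i * t * cs.simple i) := by
  simpa using ht.conj (cs.simple i)

theorem IsReflection.inversionSign_of_commute {cs : CoxeterSystem M W} {r t : W}
    (hr : cs.IsReflection r) (hne : t ≠ r) (hcomm : r * t = t * r) :
    cs.inversionSign r t = 0 := by
  classical
  obtain ⟨w, i, rfl⟩ := hr
  set q := w⁻¹ * t * w with hq
  have hqne : q ≠ cs.simple i := by
    intro h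
    exact hne (by rw [← h, hq]; group)
  have hqc : cs.simple i * q * cs.simple i = q := by
    have : cs.simple i * q = q * cs.simple i := by
      have h1 := congrArg (fun z ↦ w⁻¹ * z * w) hcomm
      simp only [mul_assoc, inv_mul_cancel_left, inv_mul_cancel, mul_one] at h1
      simp only [hq, mul_assoc]
      exact h1
    rw [this, simple_mul_simple_cancel_right]
  have ht : t = w * q * w⁻¹ := by rw [hq]; group
  have hqt : w⁻¹ * t * w⁻¹⁻¹ = q := by rw [hq, inv_inv]
  rw [inversionSign_mul, inversionSign_mul, hqt, inversionSign_simple, if_neg hqne, inv_simple,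
    hqc]
  nth_rw 1 [ht]
  rw [inversionSign_inv, zero_add, CharTwo.add_self_eq_zero]

theorem IsReflection.length_simple_conj {cs : CoxeterSystem M W} {t : W}
    (ht : cs.IsReflection t) {i : B} (hi : cs.IsRightDescent t i) (hne : t ≠ cs.simple i) :
    cs.length (cs.simple i * t * cs.simple i) + 2 = cs.length t := by
  refine cs.length_simple_mul_mul_simple_of_descents (ht.isLeftDescent_iff.mpr hi) hi fun h ↦ ?_
  exact cs.isRightDescent_iff_inversionSign.mp hi (ht.inversionSign_of_commute hne.symm h.symm)

/-- Every reflection has a palindromic reduced expression. -/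
theorem IsReflection.exists_eq_conj {cs : CoxeterSystem M W} {t : W} (ht : cs.IsReflection t) :
    ∃ w i, t = w * cs.simple i * w⁻¹ ∧ cs.length t = 2 * cs.length w + 1 := by
  induction hn : cs.length t using Nat.strong_induction_on generalizing t with
  | _ n ih =>
    have hne : t ≠ 1 := by
      rintro rfl
      simpa using ht.odd_length
    obtain ⟨i, hi⟩ := cs.exists_rightDescent_of_ne_one hne
    by_cases h : t = cs.simple i
    · exact ⟨1, i, by simp [h], by simp [← hn, h]⟩
    · have hlen := ht.length_simple_conj hi h
      obtain ⟨w, j, hw, hwlen⟩ := ih _ (by omega) (ht.simple_conj i) rfl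
      have heq : t = cs.simple i * w * cs.simple j * (cs.simple i * w)⁻¹ := by
        rw [mul_inv_rev, inv_simple]
        calc t = cs.simple i * (cs.simple i * t * cs.simple i) * cs.simple i := by
              simp [mul_assoc]
          _ = _ := by rw [hw]; simp only [mul_assoc]
      refine ⟨cs.simple i * w, j, heq, ?_⟩
      have h1 := cs.length_simple_mul w i
      have h2 := cs.length_mul_le (cs.simple i * w * cs.simple j) (cs.simple i * w)⁻¹
      have h3 := cs.length_mul_le (cs.simple i * w) (cs.simple j)
      rw [← heq, length_inv] at h2
      rw [length_simple] at h3
      omega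

/-- A reflection having neither `i` nor `j` as a descent does not interchange the simple
reflections `i ≠ j` by conjugation. -/
theorem IsReflection.simple_eq_of_simple_mul_eq {cs : CoxeterSystem M W} {t : W}
    (ht : cs.IsReflection t) {i j : B} (hi : ¬cs.IsRightDescent t i)
    (hj : ¬cs.IsRightDescent t j) (h : cs.simple i * t = t * cs.simple j) :
    cs.simple i = cs.simple j := by
  classical
  by_contra hne
  have hji : cs.simple j * t = t * cs.simple i := by
    have := congrArg (fun w ↦ t * w * t) h
    simpa [mul_assoc, ht.mul_self, ← mul_assoc t t] using this.symm
  have hci : cs.simple i * t ≠ t * cs.simple i := fun hc ↦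
    hne (mul_left_cancel (hc.symm.trans h))
  have hcj : cs.simple j * t ≠ t * cs.simple j := fun hc ↦
    hne (mul_left_cancel (hji.symm.trans hc))
  have hleni := cs.length_simple_mul_mul_simple_of_ascents (mt ht.isLeftDescent_iff.mp hi) hi hci
  have hlenj := cs.length_simple_mul_mul_simple_of_ascents (mt ht.isLeftDescent_iff.mp hj) hj hcj
  obtain ⟨y, k, hy, hylen⟩ := ht.exists_eq_conj
  have small : ∀ e, cs.IsReflection e → cs.length e = cs.length t + 2 →
      cs.inversionSign y⁻¹ e = 0 := by
    intro e he hlen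
    by_contra hcon
    have h1 := cs.length_mul_lt_of_inversionSign hcon
    have h2 := cs.length_mul_le y (y⁻¹ * e)
    rw [mul_inv_cancel_left] at h2
    rw [length_inv] at h1
    omega
  set e := cs.simple i * t * cs.simple i with he
  have hte : t * e * t = cs.simple j * t * cs.simple j := by
    rw [he, hji, h]
    simp only [mul_assoc]
    rw [← mul_assoc t t, ht.mul_self, one_mul, h, ← mul_assoc, hji, mul_assoc]
  have h1 := small e (ht.simple_conj i) hleni
  have h2 := small (t * e * t) (hte ▸ ht.simple_conj j) (hte ▸ hlenj)
  have hyt : y⁻¹ * t = cs.simple k * y⁻¹ := by rw [hy]; group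
  have h3 := cs.inversionSign_mul y⁻¹ t e
  have hf : y⁻¹ * e * y⁻¹⁻¹ ≠ cs.simple k := by
    intro hf
    have het : e = t := by rw [hy, ← hf]; group
    rw [het] at hleni
    omega
  rw [ht.inv, h2, add_zero, hyt, inversionSign_mul, h1, inversionSign_simple, if_neg hf,
    zero_add] at h3
  have h4 := (cs.inversionSign_eq_zero_iff (ht.simple_conj i)).mp h3.symm
  have hte' : t * (cs.simple i * t * cs.simple i) = cs.simple j * cs.simple i := by
    rw [← mul_assoc, ← mul_assoc, ← hji, mul_assoc (cs.simple j), ht.mul_self, mul_one]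
  rw [hte'] at h4
  have h5 := cs.length_mul_le (cs.simple j) (cs.simple i)
  rw [length_simple, length_simple] at h5
  obtain ⟨l, hl⟩ := cs.length_eq_one_iff.mp (show cs.length t = 1 by omega)
  have h6 : cs.simple l * cs.simple i ≠ cs.simple i * cs.simple l := by
    rw [← hl]
    exact hci.symm
  have h7 : ¬cs.IsRightDescent (cs.simple i) l := by
    intro h7
    have := cs.isRightDescent_iff.mp h7
    rw [length_simple, add_eq_right, length_eq_zero_iff, mul_eq_one_iff_eq_inv, inv_simple] at this
    exact h6 (by rw [this])
  have h8 := cs.not_isRightDescent_iff.mp (mt (cs.isRightDescent_simple_mul_iff h6).mp h7)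
  have h9 : cs.simple l * cs.simple i * cs.simple l = cs.simple j := by
    rw [← hl, ← hji, mul_assoc, ht.mul_self, mul_one]
  rw [h9, length_simple] at h8
  have h10 : cs.simple l * cs.simple i = 1 := cs.length_eq_zero_iff.mp (by omega)
  rw [mul_eq_one_iff_eq_inv, inv_simple] at h10
  exact h6 (by rw [h10])

/-! ### The Bruhat order by chains of reflections -/

/-- The Bruhat order, generated by the relations `u ≤ t * u` for reflections `t` with
`ℓ u < ℓ (t * u)`. -/
def Bruhat : W → W → Prop :=
  Relation.ReflTransGen fun u v ↦ cs.IsReflection (v * u⁻¹) ∧ cs.length u < cs.length v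

variable {cs} {u v w : W}

namespace Bruhat

theorem refl (u : W) : cs.Bruhat u u := Relation.ReflTransGen.refl

theorem trans (h : cs.Bruhat u v) (h' : cs.Bruhat v w) : cs.Bruhat u w :=
  Relation.ReflTransGen.trans h h'

theorem of_reflection_mul {t : W} (ht : cs.IsReflection t)
    (h : cs.length u < cs.length (t * u)) : cs.Bruhat u (t * u) :=
  Relation.ReflTransGen.single ⟨by simpa using ht, h⟩

theorem of_simple_mul {i : B} (h : cs.length u < cs.length (cs.simple i * u)) :
    cs.Bruhat u (cs.simple i * u) :=
  of_reflection_mul (cs.isReflection_simple i) h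

theorem simple_mul_of_lt {i : B} (h : cs.length (cs.simple i * u) < cs.length u) :
    cs.Bruhat (cs.simple i * u) u := by
  simpa using of_simple_mul (cs := cs) (u := cs.simple i * u) (i := i) (by simpa using h)

theorem length_le (h : cs.Bruhat u v) : cs.length u ≤ cs.length v := by
  induction h with
  | refl => rfl
  | tail _ h ih => exact ih.trans h.2.le

theorem eq_of_length_le (h : cs.Bruhat u v) (hl : cs.length v ≤ cs.length u) : u = v := by
  rcases Relation.ReflTransGen.cases_tail h with rfl | ⟨w, hw, h'⟩
  · rfl
  · exact absurd (length_le hw) (by have := h'.2; omega)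

theorem exists_sublist (h : cs.Bruhat u v) :
    ∀ ω : List B, cs.wordProd ω = v → ∃ ω' : List B, ω'.Sublist ω ∧ cs.wordProd ω' = u := by
  induction h with
  | refl => exact fun ω hω ↦ ⟨ω, List.Sublist.refl _, hω⟩
  | @tail x y _ h ih =>
    rintro ω rfl
    have h1 : cs.wordProd ω * ((cs.wordProd ω)⁻¹ * x) = x := by group
    have ht : cs.IsReflection ((cs.wordProd ω)⁻¹ * x) := by
      have h2 := h.1.inv ▸ h.1.conj (cs.wordProd ω)⁻¹
      convert h2 using 1
      have h3 := h.1.inv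
      group at h3 ⊢
    obtain ⟨j, _, hj⟩ := cs.exists_eraseIdx_of_length_mul_lt ω ht (by rw [h1]; exact h.2)
    obtain ⟨ω', hsub, hω'⟩ := ih _ (hj.symm.trans h1)
    exact ⟨ω', hsub.trans (List.eraseIdx_sublist _ _), hω'⟩

theorem simple_mul (h : cs.Bruhat u v) (i : B) :
    cs.Bruhat (cs.simple i * u) v ∨ cs.Bruhat (cs.simple i * u) (cs.simple i * v) := by
  classical
  induction h with
  | refl => exact Or.inr (refl _)
  | @tail x y hx h ih =>
    obtain ⟨t, ht⟩ : ∃ t, t = y * x⁻¹ := ⟨_, rfl⟩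
    obtain rfl : y = t * x := by rw [ht]; group
    rw [← ht] at h
    rcases ih with ih | ih
    · exact Or.inl (ih.trans (of_reflection_mul h.1 h.2))
    by_cases hti : t = cs.simple i
    · exact Or.inl (hti ▸ ih)
    refine Or.inr (ih.trans ?_)
    have h1 : cs.simple i * (t * x) = cs.simple i * t * (cs.simple i)⁻¹ * (cs.simple i * x) := by
      group
    rw [h1]
    refine of_reflection_mul (h.1.conj _) ?_
    rw [← h1]
    have hq : cs.IsReflection (x⁻¹ * t * x) := by simpa using h.1.conj x⁻¹
    have hxq : x * (x⁻¹ * t * x) * x⁻¹ = t := by group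
    have h2 : cs.inversionSign (cs.simple i * x) (x⁻¹ * t * x) = 0 := by
      rw [inversionSign_mul, hxq, inversionSign_simple, if_neg hti, add_zero,
        cs.inversionSign_eq_zero_iff hq]
      convert h.2 using 2
      group
    rw [cs.inversionSign_eq_zero_iff hq] at h2
    convert h2 using 2
    group

theorem of_sublist {ω' ω : List B} (hsub : ω'.Sublist ω) (hred : cs.IsReduced ω) :
    cs.Bruhat (cs.wordProd ω') (cs.wordProd ω) := by
  induction hsub with
  | slnil => exact refl _
  | @cons ω' ω i _ ih =>
    have hred' : cs.IsReduced ω := by simpa using hred.drop 1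
    refine (ih hred').trans ?_
    rw [wordProd_cons]
    refine of_simple_mul ?_
    rw [← wordProd_cons, hred.eq, hred'.eq]
    simp
  | @cons_cons ω' ω i _ ih =>
    have hred' : cs.IsReduced ω := by simpa using hred.drop 1
    rw [wordProd_cons, wordProd_cons]
    rcases (ih hred').simple_mul i with h | h
    · refine h.trans (of_simple_mul ?_)
      rw [← wordProd_cons, hred.eq, hred'.eq]
      simp
    · exact h

theorem simple_mul_le (h : cs.Bruhat u v) {i : B} (hi : cs.IsLeftDescent v i) :
    cs.Bruhat (cs.simple i * u) v :=
  (h.simple_mul i).elim id fun h' ↦ h'.trans (simple_mul_of_lt hi)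

theorem le_simple_mul (h : cs.Bruhat u v) {i : B} (hu : ¬cs.IsLeftDescent u i) :
    cs.Bruhat u (cs.simple i * v) := by
  obtain ⟨ω, hω, hωv⟩ := cs.exists_isReduced (cs.simple i * v)
  obtain ⟨σ, hσ, rfl⟩ := h.exists_sublist (i :: ω) (by rw [wordProd_cons, ← hωv]; simp)
  rw [hωv]
  cases hσ with
  | cons _ hσ => exact of_sublist hσ hω
  | cons_cons _ hσ =>
    refine .trans ?_ (of_sublist hσ hω)
    rw [wordProd_cons] at hu ⊢
    refine simple_mul_of_lt ?_
    have := cs.not_isLeftDescent_iff.mp hu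
    rw [simple_mul_simple_cancel_left] at this
    omega

theorem mul (hu : cs.Bruhat u v) {u' v' : W} (hu' : cs.Bruhat u' v')
    (hl : cs.length (v * v') = cs.length v + cs.length v') : cs.Bruhat (u * u') (v * v') := by
  obtain ⟨ω, hω, rfl⟩ := cs.exists_isReduced v
  obtain ⟨ω', hω', rfl⟩ := cs.exists_isReduced v'
  obtain ⟨σ, hσ, rfl⟩ := hu.exists_sublist ω rfl
  obtain ⟨σ', hσ', rfl⟩ := hu'.exists_sublist ω' rfl
  rw [← wordProd_append, ← wordProd_append]
  refine of_sublist (hσ.append hσ') ?_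
  rw [IsReduced, wordProd_append, hl, hω.eq, hω'.eq, List.length_append]

theorem inv (h : cs.Bruhat u v) : cs.Bruhat u⁻¹ v⁻¹ := by
  induction h with
  | refl => exact refl _
  | @tail x y _ h ih =>
    refine ih.trans (Relation.ReflTransGen.single ⟨?_, by simpa using h.2⟩)
    have h1 := h.1.inv
    have h2 := h.1.conj y⁻¹
    convert h2 using 1
    rw [← h1]
    group

theorem one_le (u : W) : cs.Bruhat 1 u := by
  obtain ⟨ω, hω, rfl⟩ := cs.exists_isReduced u
  simpa using of_sublist (List.nil_sublist ω) hω

end Bruhat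

theorem Bruhat.of_mem_parabolic {J : Set B} (hJ : ∀ i ∈ J, cs.IsLeftDescent v i)
    (hu : u ∈ cs.parabolic J) : cs.Bruhat u v := by
  obtain ⟨ω, hω, -, rfl⟩ := cs.exists_isReduced_of_mem_parabolic hu
  clear hu
  induction ω with
  | nil => simpa using Bruhat.one_le v
  | cons i ω ih =>
    rw [wordProd_cons]
    exact (ih fun k hk ↦ hω k (by simp [hk])).simple_mul_le (hJ i (hω i (by simp)))

/-! ### Involutive automorphisms preserving the simple reflections -/

variable (cs) in
/-- `θ` is an involutive automorphism mapping `cs.simple i` to `cs.simple (τ i)`. -/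
structure IsDiagramInvolution (θ : W ≃* W) (τ : B → B) : Prop where
  involutive : Function.Involutive θ
  map_simple : ∀ i, θ (cs.simple i) = cs.simple (τ i)

namespace IsDiagramInvolution

variable {θ : W ≃* W} {τ : B → B}

theorem map_wordProd (D : cs.IsDiagramInvolution θ τ) (ω : List B) :
    θ (cs.wordProd ω) = cs.wordProd (ω.map τ) := by
  induction ω with
  | nil => simp
  | cons i ω ih => simp [wordProd_cons, ih, D.map_simple]

theorem length_map (D : cs.IsDiagramInvolution θ τ) (w : W) :
    cs.length (θ w) = cs.length w := by
  have h : ∀ w, cs.length (θ w) ≤ cs.length w := by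
    intro w
    obtain ⟨ω, hω, rfl⟩ := cs.exists_isReduced w
    rw [D.map_wordProd, hω.eq]
    simpa using cs.length_wordProd_le (ω.map τ)
  refine (h w).antisymm ?_
  simpa [D.involutive w] using h (θ w)

theorem isReflection_map (D : cs.IsDiagramInvolution θ τ) {t : W} (ht : cs.IsReflection t) :
    cs.IsReflection (θ t) := by
  obtain ⟨w, i, rfl⟩ := ht
  exact ⟨θ w, τ i, by simp [D.map_simple]⟩

theorem inversionSign_map (D : cs.IsDiagramInvolution θ τ) (w : W) {t : W}
    (ht : cs.IsReflection t) : cs.inversionSign (θ w) (θ t) = cs.inversionSign w t := by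
  have key : ∀ a b : ZMod 2, (a = 0 ↔ b = 0) → a = b := by decide
  refine key _ _ ?_
  rw [cs.inversionSign_eq_zero_iff ht, cs.inversionSign_eq_zero_iff (D.isReflection_map ht),
    ← map_mul, D.length_map, D.length_map]

theorem map_mem_parabolic (D : cs.IsDiagramInvolution θ τ) {J : Set B} {g : W}
    (hg : g ∈ cs.parabolic J) : θ g ∈ cs.parabolic (τ '' J) := by
  obtain ⟨ω, hω, -, rfl⟩ := cs.exists_isReduced_of_mem_parabolic hg
  rw [D.map_wordProd]
  refine cs.wordProd_mem_parabolic fun i hi ↦ ?_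
  obtain ⟨k, hk, rfl⟩ := List.mem_map.mp hi
  exact ⟨k, hω k hk, rfl⟩

theorem bruhat_map (D : cs.IsDiagramInvolution θ τ) (h : cs.Bruhat u v) :
    cs.Bruhat (θ u) (θ v) := by
  induction h with
  | refl => exact .refl _
  | @tail x y _ h ih =>
    refine ih.trans (Relation.ReflTransGen.single ⟨?_, ?_⟩)
    · simpa using D.isReflection_map h.1
    · simpa [D.length_map] using h.2

theorem isLeftDescent_iff (D : cs.IsDiagramInvolution θ τ) (hw : θ w = w⁻¹) (i : B) :
    cs.IsLeftDescent w (τ i) ↔ cs.IsRightDescent w i := by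
  rw [IsLeftDescent, IsRightDescent, ← D.map_simple, ← D.length_map, map_mul, D.involutive, hw,
    ← length_inv, mul_inv_rev, inv_inv, inv_simple]

theorem length_conj_of_descent (D : cs.IsDiagramInvolution θ τ) (hw : θ w = w⁻¹) {i : B}
    (hi : cs.IsRightDescent w i) (hne : θ (cs.simple i) * w * cs.simple i ≠ w) :
    cs.length (θ (cs.simple i) * w * cs.simple i) + 2 = cs.length w := by
  rw [D.map_simple] at hne ⊢
  refine cs.length_simple_mul_mul_simple_of_descents ((D.isLeftDescent_iff hw i).mpr hi) hi ?_
  intro h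
  exact hne (by rw [h]; simp)

theorem length_conj_of_ascent (D : cs.IsDiagramInvolution θ τ) (hw : θ w = w⁻¹) {i : B}
    (hi : ¬cs.IsRightDescent w i) (hne : θ (cs.simple i) * w * cs.simple i ≠ w) :
    cs.length (θ (cs.simple i) * w * cs.simple i) = cs.length w + 2 := by
  rw [D.map_simple] at hne ⊢
  refine cs.length_simple_mul_mul_simple_of_ascents (mt (D.isLeftDescent_iff hw i).mp hi) hi ?_
  intro h
  exact hne (by rw [h]; simp)

/-- If `v = θ(w)⁻¹ w` and `θ(s) v s = v` then `s` is not a right descent of `v`. -/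
theorem not_isRightDescent (D : cs.IsDiagramInvolution θ τ) (w : W) {i : B}
    (h : θ (cs.simple i) * (θ w⁻¹ * w) * cs.simple i = θ w⁻¹ * w) :
    ¬cs.IsRightDescent (θ w⁻¹ * w) i := by
  have ht : cs.IsReflection (w * cs.simple i * w⁻¹) := (cs.isReflection_simple i).conj w
  have hθ : θ (w * cs.simple i * w⁻¹) = w * cs.simple i * w⁻¹ := by
    have h1 : θ (cs.simple i) = (θ w⁻¹ * w) * cs.simple i * (θ w⁻¹ * w)⁻¹ := by
      rw [eq_mul_inv_iff_mul_eq]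
      nth_rw 1 [← h]
      rw [← mul_assoc, ← mul_assoc, ← map_mul, simple_mul_simple_self]
      simp [← mul_assoc]
    rw [map_mul, map_mul, h1]
    simp [mul_assoc]
  rw [isRightDescent_iff_inversionSign, inversionSign_mul, not_not]
  nth_rw 1 [← hθ]
  rw [D.inversionSign_map _ ht, inversionSign_inv, CharTwo.add_self_eq_zero]

end IsDiagramInvolution

end CoxeterSystem

namespace CoxeterSystem

variable {B : Type*} {W : Type*} [Group W] {M : CoxeterMatrix B} {cs : CoxeterSystem M W}

/-! ### Dihedral parabolic subgroups -/

theorem commute_of_mem_parabolic {J : Set B} {d g : W} (h : ∀ i ∈ J, Commute (cs.simple i) d)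
    (hg : g ∈ cs.parabolic J) : Commute g d := by
  obtain ⟨ω, hω, -, rfl⟩ := cs.exists_isReduced_of_mem_parabolic hg
  clear hg
  induction ω with
  | nil => simp
  | cons i ω ih =>
    rw [wordProd_cons]
    exact (h i (hω i (by simp))).mul_left (ih fun k hk ↦ hω k (by simp [hk]))

theorem simple_mul_zpow (i j : B) (n : ℤ) :
    cs.simple i * (cs.simple i * cs.simple j) ^ n =
      (cs.simple i * cs.simple j) ^ (-n) * cs.simple i := by
  have h : cs.simple i * (cs.simple i * cs.simple j) * (cs.simple i)⁻¹ =
      (cs.simple i * cs.simple j)⁻¹ := by simp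
  rw [zpow_neg, ← inv_zpow, ← h, conj_zpow, inv_mul_cancel_right]

theorem simple_eq_zpow_mul (i j : B) :
    cs.simple j = (cs.simple i * cs.simple j) ^ (-1 : ℤ) * cs.simple i := by
  simp

theorem exists_zpow_of_mem_parabolic {i j : B} {x : W} (hx : x ∈ cs.parabolic {i, j}) :
    ∃ n : ℤ, x = (cs.simple i * cs.simple j) ^ n ∨
      x = (cs.simple i * cs.simple j) ^ n * cs.simple i := by
  obtain ⟨ω, hω, -, rfl⟩ := cs.exists_isReduced_of_mem_parabolic hx
  clear hx
  induction ω with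
  | nil => exact ⟨0, by simp⟩
  | cons k ω ih =>
    obtain ⟨n, hn⟩ := ih fun k hk ↦ hω k (by simp [hk])
    rw [wordProd_cons]
    rcases (by simpa using hω k (by simp) : k = i ∨ k = j) with rfl | rfl
    · refine ⟨-n, hn.symm.imp (fun h ↦ ?_) fun h ↦ ?_⟩
      · rw [h, ← mul_assoc, simple_mul_zpow, simple_mul_simple_cancel_right]
      · rw [h, simple_mul_zpow]
    · refine ⟨-1 + -n, hn.symm.imp (fun h ↦ ?_) fun h ↦ ?_⟩
      · nth_rw 1 [simple_eq_zpow_mul i k]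
        rw [h, mul_assoc, ← mul_assoc (cs.simple i), simple_mul_zpow,
          simple_mul_simple_cancel_right, zpow_add]
      · nth_rw 1 [simple_eq_zpow_mul i k]
        rw [h, mul_assoc, simple_mul_zpow, zpow_add, mul_assoc]

theorem exists_zpow_eq_one_of_swap {i j : B} {x : W} (hx : x ∈ cs.parabolic {i, j})
    (hr : cs.IsReflection x) {f : W →* W} (hi : f (cs.simple i) = cs.simple j)
    (hj : f (cs.simple j) = cs.simple i) (hf : f x = x) :
    (∃ n : ℤ, (cs.simple i * cs.simple j) ^ (2 * n + 1) = 1) ∧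
      x * cs.simple i * x⁻¹ = cs.simple j := by
  obtain ⟨n, rfl | rfl⟩ := exists_zpow_of_mem_parabolic hx
  · have h := congrArg Multiplicative.toAdd (cs.lengthParity_eq_ofAdd_length
      ((cs.simple i * cs.simple j) ^ n))
    rw [map_zpow, map_mul, lengthParity_simple, lengthParity_simple] at h
    have h2 : Multiplicative.ofAdd (1 : ZMod 2) * Multiplicative.ofAdd 1 = 1 := by decide
    rw [h2, one_zpow, toAdd_one, toAdd_ofAdd] at h
    exact absurd ((ZMod.natCast_eq_zero_iff_even).mp h.symm) (Nat.not_even_iff_odd.mpr hr.odd_length)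
  · set ρ := cs.simple i * cs.simple j with hρ
    have hji : f ρ = ρ⁻¹ := by rw [hρ, map_mul, hi, hj]; simp
    have h1 : ρ ^ (2 * n + 1) = 1 := by
      rw [map_mul, map_zpow, hji, hi, simple_eq_zpow_mul i j, ← hρ, ← mul_assoc, inv_zpow',
        ← zpow_add, mul_left_inj] at hf
      have h2 : 2 * n + 1 = n - (-n + -1) := by ring
      rw [h2, zpow_sub, hf, mul_inv_cancel]
    refine ⟨⟨n, h1⟩, ?_⟩
    have h3 : ρ ^ n * cs.simple i * cs.simple i * (ρ ^ n * cs.simple i)⁻¹ =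
        ρ ^ n * (cs.simple i * ρ ^ (-n)) := by
      simp [mul_assoc]
    rw [h3, simple_mul_zpow, ← mul_assoc, ← hρ, ← zpow_add, simple_eq_zpow_mul i j, ← hρ,
      mul_left_inj, ← mul_inv_eq_one, ← zpow_neg, ← zpow_add, ← h1]
    congr 1
    ring

/-! ### Fixed reflections under the NOF property -/

theorem IsReflection.exists_conj_parabolic {r : W} (hr : cs.IsReflection r) (J : Set B) :
    ∃ g ∈ cs.parabolic J, ∃ d, cs.IsReflection d ∧ r = g * d * g⁻¹ ∧
      (d = r ∨ cs.length d < cs.length r) ∧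
      (d ∈ cs.parabolic J ∨ ∀ j ∈ J, ¬cs.IsRightDescent d j) := by
  induction hn : cs.length r using Nat.strong_induction_on generalizing r with
  | _ n ih =>
    by_cases h : ∀ j ∈ J, ¬cs.IsRightDescent r j
    · exact ⟨1, one_mem _, r, hr, by simp, Or.inl rfl, Or.inr h⟩
    push Not at h
    obtain ⟨j, hj, hd⟩ := h
    by_cases hrj : r = cs.simple j
    · exact ⟨1, one_mem _, r, hr, by simp, Or.inl rfl, Or.inl (hrj ▸ cs.simple_mem_parabolic hj)⟩
    have hlen := hr.length_simple_conj hd hrj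
    obtain ⟨g, hg, d, hd, heq, hdl, hd'⟩ := ih _ (by omega) (hr.simple_conj j) rfl
    refine ⟨cs.simple j * g, mul_mem (cs.simple_mem_parabolic hj) hg, d, hd, ?_, Or.inr ?_, hd'⟩
    · calc r = cs.simple j * (cs.simple j * r * cs.simple j) * cs.simple j := by simp [mul_assoc]
        _ = _ := by rw [heq]; simp [mul_assoc]
    · rcases hdl with rfl | hdl <;> omega

/-- Under the NOF property, every reflection fixed by `θ` is conjugate to a simple reflection by
an element fixed by `θ`. -/
theorem IsDiagramInvolution.exists_fixed_conj_eq_simple {θ : W ≃* W} {τ : B → B}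
    (D : cs.IsDiagramInvolution θ τ)
    (hNOF : ∀ i, θ (cs.simple i) ≠ cs.simple i →
      Even (orderOf (cs.simple i * θ (cs.simple i))) ∨
        orderOf (cs.simple i * θ (cs.simple i)) = 0)
    {r : W} (hr : cs.IsReflection r) (hθr : θ r = r) :
    ∃ z, θ z = z ∧ ∃ i, z * r * z⁻¹ = cs.simple i := by
  induction hn : cs.length r using Nat.strong_induction_on generalizing r with
  | _ n ih =>
    have hne : r ≠ 1 := by
      rintro rfl
      simpa using hr.odd_length
    obtain ⟨i, hi⟩ := cs.exists_rightDescent_of_ne_one hne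
    by_cases h : r = cs.simple i
    · exact ⟨1, by simp, i, by simp [h]⟩
    by_cases hfix : θ (cs.simple i) = cs.simple i
    · have hlen := hr.length_simple_conj hi h
      obtain ⟨z, hz, k, hk⟩ := ih _ (by omega) (hr.simple_conj i) (by simp [hfix, hθr]) rfl
      exact ⟨z * cs.simple i, by simp [hz, hfix], k, by rw [← hk]; simp [mul_assoc]⟩
    have hij : θ (cs.simple i) = cs.simple (τ i) := D.map_simple i
    have hji : θ (cs.simple (τ i)) = cs.simple i := by rw [← hij, D.involutive]
    have hpar : ∀ g ∈ cs.parabolic {i, τ i}, θ g ∈ cs.parabolic {i, τ i} := by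
      intro g hg
      have := D.map_mem_parabolic hg
      rwa [parabolic, Set.image_pair, Set.image_pair, ← D.map_simple (τ i), hji, Set.pair_comm,
        ← Set.image_pair] at this
    have hnot : r ∉ cs.parabolic {i, τ i} := by
      intro hmem
      obtain ⟨⟨m, hm⟩, -⟩ := exists_zpow_eq_one_of_swap (f := θ.toMonoidHom) hmem hr hij hji hθr
      rw [← hij, ← orderOf_dvd_iff_zpow_eq_one] at hm
      rcases hNOF i hfix with h | h
      · have := (Int.natCast_dvd_natCast.mpr h.two_dvd).trans hm
        omega
      · rw [h] at hm
        simp only [Nat.cast_zero, zero_dvd_iff] at hm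
        omega
    obtain ⟨g, hg, d, hd, heq, hdr, hd'⟩ := hr.exists_conj_parabolic {i, τ i}
    have hnd := hd'.resolve_left fun hd' ↦
      hnot (heq ▸ mul_mem (mul_mem hg hd') (inv_mem hg))
    have hlt := hdr.resolve_left fun hdr ↦ hnd i (by simp) (hdr ▸ hi)
    have hθd := D.isReflection_map hd
    have hndθ : ∀ j ∈ ({i, τ i} : Set B), ¬cs.IsRightDescent (θ d) j := by
      rintro j (rfl | rfl)
      · rw [IsRightDescent, ← hji, ← map_mul, D.length_map, D.length_map]
        exact hnd _ (by simp)
      · rw [IsRightDescent, ← hij, ← map_mul, D.length_map, D.length_map]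
        exact hnd _ (by simp)
    have hh : g⁻¹ * θ g ∈ cs.parabolic {i, τ i} := mul_mem (inv_mem hg) (hpar g hg)
    have hcomm : g⁻¹ * θ g * θ d = d * (g⁻¹ * θ g) := by
      rw [heq] at hθr
      simp only [map_mul, map_inv] at hθr
      rw [mul_inv_eq_iff_eq_mul] at hθr
      rw [mul_assoc, hθr]
      group
    obtain ⟨ω, hω, hred, hprod⟩ := cs.exists_isReduced_of_mem_parabolic hh
    have hletter : ∀ a ∈ ω, Commute (cs.simple a) d := by
      intro a ha
      obtain ⟨b, hb, hab⟩ := cs.exists_simple_mul_eq_mul_simple hnd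
        (fun j hj ↦ mt hd.isLeftDescent_iff.mp (hnd j hj))
        (fun j hj ↦ mt hθd.isLeftDescent_iff.mp (hndθ j hj)) hω hred hh (by rw [hprod, hcomm]) a ha
      have := hd.simple_eq_of_simple_mul_eq (hnd a (hω a ha)) (hnd b hb) hab
      rw [← this] at hab
      exact hab
    have hθd : θ d = d := by
      have h1 : Commute (g⁻¹ * θ g) d := by
        refine commute_of_mem_parabolic (J := {a | a ∈ ω}) hletter ?_
        rw [← hprod]
        exact cs.wordProd_mem_parabolic fun i hi ↦ hi
      rw [← h1.eq] at hcomm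
      exact mul_left_cancel hcomm
    rcases ω with - | ⟨a, ω⟩
    · have hgθ : θ g = g := by
        rw [wordProd_nil] at hprod
        exact (inv_mul_eq_one.mp hprod.symm).symm
      obtain ⟨z, hz, k, hk⟩ := ih _ (by omega) hd hθd rfl
      refine ⟨z * g⁻¹, by simp [hz, hgθ], k, ?_⟩
      rw [← hk, heq]
      group
    · have ha := hletter a (by simp)
      have hθa : Commute (θ (cs.simple a)) d := by
        have := ha.map θ
        rwa [hθd] at this
      have hall : ∀ j ∈ ({i, τ i} : Set B), Commute (cs.simple j) d := by
        rcases hω a (by simp) with rfl | rfl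
        · rintro j (rfl | rfl)
          exacts [ha, hij ▸ hθa]
        · rintro j (rfl | rfl)
          exacts [hji ▸ hθa, ha]
      have h1 := commute_of_mem_parabolic hall hg
      rw [h1.eq, mul_inv_cancel_right] at heq
      rw [heq] at hn hlt
      exact absurd hlt (lt_irrefl _)

end CoxeterSystem

namespace CoxeterSystem

variable {B : Type*} {W : Type*} [Group W] {M : CoxeterMatrix B} {cs : CoxeterSystem M W}
variable {θ : W ≃* W} {τ : B → B}

theorem Bruhat.le_mul_simple {u v : W} (h : cs.Bruhat u v) {i : B}
    (hu : ¬cs.IsRightDescent u i) : cs.Bruhat u (v * cs.simple i) := by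
  have h1 := (h.inv.le_simple_mul (i := i) (by rwa [isLeftDescent_inv_iff])).inv
  simpa using h1

namespace IsDiagramInvolution

/-! ### Twisted conjugation -/

theorem bruhat_conj (D : cs.IsDiagramInvolution θ τ) {g h x y : W} (hg : cs.Bruhat g h)
    (hy : cs.Bruhat y x)
    (hl : cs.length (θ h⁻¹ * x * h) = cs.length x + 2 * cs.length h) :
    cs.Bruhat (θ g⁻¹ * y * g) (θ h⁻¹ * x * h) := by
  have h1 := cs.length_mul_le (θ h⁻¹ * x) h
  have h2 := cs.length_mul_le (θ h⁻¹) x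
  have h3 : cs.length (θ h⁻¹) = cs.length h := by rw [D.length_map, length_inv]
  exact ((D.bruhat_map hg.inv).mul hy (by omega)).mul hg (by omega)

theorem length_conj_le (D : cs.IsDiagramInvolution θ τ) (x h : W) :
    cs.length (θ h⁻¹ * x * h) ≤ cs.length x + 2 * cs.length h := by
  have h1 := cs.length_mul_le (θ h⁻¹ * x) h
  have h2 := cs.length_mul_le (θ h⁻¹) x
  have h3 : cs.length (θ h⁻¹) = cs.length h := by rw [D.length_map, length_inv]
  omega

theorem conj_eq (D : cs.IsDiagramInvolution θ τ) (x h : W) (i : B) :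
    θ h⁻¹ * x * h =
      θ (cs.simple i * h)⁻¹ * (θ (cs.simple i) * x * cs.simple i) * (cs.simple i * h) := by
  simp only [mul_inv_rev, map_mul, map_inv, mul_assoc, simple_mul_simple_cancel_left,
    D.map_simple, inv_simple]

theorem conj_simple_ne (D : cs.IsDiagramInvolution θ τ) {x h : W} {i : B}
    (hl : cs.length (θ h⁻¹ * x * h) = cs.length x + 2 * cs.length h)
    (hi : cs.IsLeftDescent h i) : θ (cs.simple i) * x * cs.simple i ≠ x := by
  intro heq
  have h1 := D.conj_eq x h i
  rw [heq] at h1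
  have h2 := D.length_conj_le x (cs.simple i * h)
  rw [← h1] at h2
  have := cs.isLeftDescent_iff.mp hi
  omega

theorem map_eq_inv (D : cs.IsDiagramInvolution θ τ) {x : W} (hx : ∃ w, x = θ w⁻¹ * w) :
    θ x = x⁻¹ := by
  obtain ⟨w, rfl⟩ := hx
  rw [map_mul, D.involutive, mul_inv_rev, map_inv, inv_inv]

theorem exists_conj_parabolic (D : cs.IsDiagramInvolution θ τ) {v : W}
    (hv : ∃ w, v = θ w⁻¹ * w) (J : Set B) :
    ∃ g ∈ cs.parabolic J, ∃ x, (∃ w, x = θ w⁻¹ * w) ∧ v = θ g⁻¹ * x * g ∧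
      cs.length v = cs.length x + 2 * cs.length g ∧ (∀ j ∈ J, ¬cs.IsRightDescent x j) ∧
      ∀ y, θ y = y⁻¹ → (∀ j ∈ J, ¬cs.IsRightDescent y j) → cs.Bruhat y v → cs.Bruhat y x := by
  induction hn : cs.length v using Nat.strong_induction_on generalizing v with
  | _ n ih =>
    by_cases h : ∀ j ∈ J, ¬cs.IsRightDescent v j
    · exact ⟨1, one_mem _, v, hv, by simp, by simp [hn], h, fun _ _ _ h ↦ h⟩
    push Not at h
    obtain ⟨j, hj, hd⟩ := h
    have hθv := D.map_eq_inv hv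
    have hne : θ (cs.simple j) * v * cs.simple j ≠ v := by
      obtain ⟨w, rfl⟩ := hv
      exact fun h ↦ D.not_isRightDescent w h hd
    have hlen := D.length_conj_of_descent hθv hd hne
    have hv' : ∃ w, θ (cs.simple j) * v * cs.simple j = θ w⁻¹ * w := by
      obtain ⟨w, rfl⟩ := hv
      exact ⟨w * cs.simple j, by simp [mul_assoc]⟩
    obtain ⟨g, hg, x, hx, heq, hl, hnd, hy⟩ := ih _ (by omega) hv' rfl
    have hveq : v = θ (g * cs.simple j)⁻¹ * x * (g * cs.simple j) := by
      calc v = θ (cs.simple j) * (θ (cs.simple j) * v * cs.simple j) * cs.simple j := by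
            simp [D.map_simple, mul_assoc]
        _ = _ := by rw [heq]; simp [mul_assoc]
    refine ⟨g * cs.simple j, mul_mem hg (cs.simple_mem_parabolic hj), x, hx, hveq, ?_, hnd,
      fun y hθy hynd hyv ↦ hy y hθy hynd ?_⟩
    · have h1 := D.length_conj_le x (g * cs.simple j)
      rw [← hveq] at h1
      have h2 := cs.length_mul_simple g j
      omega
    · rw [D.map_simple]
      exact (hyv.le_simple_mul (mt (D.isLeftDescent_iff hθy j).mp (hynd j hj))).le_mul_simple
        (hynd j hj)

/-- Two ascents of a twisted identity `x` are not interchanged by `x⁻¹ θ(·) x` if this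
automorphism fixes a reflection in the dihedral subgroup they generate. -/
theorem false_of_swap (D : cs.IsDiagramInvolution θ τ)
    (hNOF : ∀ i, θ (cs.simple i) ≠ cs.simple i →
      Even (orderOf (cs.simple i * θ (cs.simple i))) ∨
        orderOf (cs.simple i * θ (cs.simple i)) = 0)
    {x : W} (hx : ∃ w, x = θ w⁻¹ * w) {i j : B} (hij : cs.simple i ≠ cs.simple j)
    (hi : ¬cs.IsRightDescent x i) (hj : ¬cs.IsRightDescent x j)
    (hxi : θ (cs.simple i) * x = x * cs.simple j) (hxj : θ (cs.simple j) * x = x * cs.simple i)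
    {p : W} (hp : p ∈ cs.parabolic {i, j}) (hr : cs.IsReflection p) (hxp : θ p * x = x * p) :
    False := by
  classical
  obtain ⟨w, hw⟩ := hx
  have hwx : θ w * x = w := by rw [hw, map_inv, mul_inv_cancel_left]
  have conj_fixed : ∀ {w q q' : W}, θ w * x = w → θ q * x = x * q' →
      θ (w * q * w⁻¹) = w * q' * w⁻¹ := by
    intro w q q' hw hq
    have h1 : θ q = x * q' * x⁻¹ := eq_mul_inv_of_mul_eq hq
    have h3 : (θ w)⁻¹ = x * w⁻¹ := by
      nth_rw 2 [← hw]
      simp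
    calc θ (w * q * w⁻¹) = θ w * x * q' * w⁻¹ := by simp [h1, h3, mul_assoc]
      _ = w * q' * w⁻¹ := by rw [hw]
  obtain ⟨z, hz, k, hk⟩ := D.exists_fixed_conj_eq_simple hNOF (hr.conj w) (conj_fixed hwx hxp)
  have hyx : θ (z * w) * x = z * w := by rw [map_mul, hz, mul_assoc, hwx]
  have hyp : cs.simple k * (z * w) = z * w * p := by rw [← hk]; group
  generalize z * w = y at hyx hyp
  have key : ∀ i j, cs.simple i ≠ cs.simple j → ¬cs.IsRightDescent x i →
      θ (cs.simple j) * x = x * cs.simple i → p * cs.simple i * p⁻¹ = cs.simple j →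
      ¬cs.IsRightDescent p i := by
    intro i j hij hi hxj hpi
    have hηx : cs.inversionSign x (cs.simple i) = 0 := by
      simpa [isRightDescent_iff_inversionSign] using hi
    have hη : cs.inversionSign y (cs.simple i) = cs.inversionSign y (cs.simple j) := by
      have hxy : x = θ y⁻¹ * y := by rw [map_inv, eq_inv_mul_iff_mul_eq, hyx]
      rw [hxy, inversionSign_mul, ← conj_fixed hyx hxj,
        D.inversionSign_map _ ((cs.isReflection_simple j).conj y), inversionSign_inv] at hηx
      exact CharTwo.add_eq_zero.mp hηx
    have hne : y * cs.simple i * y⁻¹ ≠ cs.simple k := by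
      intro h
      have : p = cs.simple i := by
        rw [← h] at hyp
        simpa using hyp.symm
      exact hij (by rw [← hpi, this]; simp)
    have h1 := cs.inversionSign_mul (cs.simple k) y (cs.simple i)
    rw [hyp, inversionSign_mul, inversionSign_simple, if_neg hne, hpi, hη, add_zero,
      add_eq_right] at h1
    rw [isRightDescent_iff_inversionSign, h1]
    simp
  let f : W →* W := (MulAut.conj x⁻¹).toMonoidHom.comp θ.toMonoidHom
  have hf : ∀ q q', θ q * x = x * q' → f q = q' := by
    intro q q' h
    simp [f, mul_assoc, h]
  have hpi := (exists_zpow_eq_one_of_swap hp hr (hf _ _ hxi) (hf _ _ hxj) (hf _ _ hxp)).2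
  have hpj := (exists_zpow_eq_one_of_swap (Set.pair_comm i j ▸ hp) hr (hf _ _ hxj) (hf _ _ hxi)
    (hf _ _ hxp)).2
  have hne : p ≠ 1 := by
    rintro rfl
    simpa using hr.odd_length
  obtain ⟨a, ha, hda⟩ := cs.exists_rightDescent_of_mem_parabolic hp hne
  rcases ha with rfl | rfl
  · exact key _ _ hij hi hxj hpi hda
  · exact key _ _ hij.symm hj hxi hpj hda

theorem exists_simple_mul_eq_mul_simple (D : cs.IsDiagramInvolution θ τ)
    (hNOF : ∀ i, θ (cs.simple i) ≠ cs.simple i →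
      Even (orderOf (cs.simple i * θ (cs.simple i))) ∨
        orderOf (cs.simple i * θ (cs.simple i)) = 0)
    {x w : W} (hx : ∃ w, x = θ w⁻¹ * w) {i k : B} (hik : cs.simple i ≠ cs.simple k)
    (hnd : ∀ j ∈ ({i, k} : Set B), ¬cs.IsRightDescent x j)
    (hw : w ∈ cs.parabolic {i, k}) (hw1 : w ≠ 1)
    (hl : cs.length (θ w⁻¹ * x * w) = cs.length x + 2 * cs.length w)
    (h : θ (cs.simple i) * (θ w⁻¹ * x * w) * cs.simple i = θ w⁻¹ * x * w) :
    ∃ a ∈ ({i, k} : Set B), w * cs.simple i = cs.simple a * w ∧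
      θ (cs.simple a) * x * cs.simple a = x := by
  have hθx := D.map_eq_inv hx
  obtain ⟨p, hp⟩ : ∃ p, p = w * cs.simple i * w⁻¹ := ⟨_, rfl⟩
  have hr : cs.IsReflection p := hp ▸ (cs.isReflection_simple i).conj w
  have hpJ : p ∈ cs.parabolic {i, k} := by
    rw [hp]
    exact mul_mem (mul_mem hw (cs.simple_mem_parabolic (by simp))) (inv_mem hw)
  have hxp : θ p * x = x * p := by
    have h1 : θ (cs.simple i) * (θ w⁻¹ * x * w) = θ w⁻¹ * x * w * cs.simple i := by
      nth_rw 2 [← h]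
      simp
    rw [hp, map_mul, map_mul]
    calc θ w * θ (cs.simple i) * θ w⁻¹ * x =
        θ w * (θ (cs.simple i) * (θ w⁻¹ * x * w)) * w⁻¹ := by group
      _ = _ := by rw [h1, map_inv]; group
  suffices hs : ∃ a ∈ ({i, k} : Set B), p = cs.simple a by
    obtain ⟨a, ha, hpa⟩ := hs
    refine ⟨a, ha, ?_, ?_⟩
    · rw [← hpa, hp, inv_mul_cancel_right]
    · rw [← hpa, hxp, mul_assoc, hr.mul_self, mul_one]
  by_contra! hcon
  have hne : p ≠ 1 := by
    rintro rfl
    simpa using hr.odd_length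
  obtain ⟨ω, hω, hred, hprod⟩ := cs.exists_isReduced_of_mem_parabolic hpJ
  have hmem : ∀ a ∈ ({i, k} : Set B), ∀ b ∈ ({i, k} : Set B), (∀ c ∈ ω, c = a ∨ c = b) →
      a ∈ ω := by
    intro a ha b hb hc
    by_contra haω
    have h1 : p ∈ cs.parabolic {b, b} := by
      rw [← hprod]
      refine cs.wordProd_mem_parabolic fun c hcω ↦ ?_
      rcases hc c hcω with rfl | rfl
      · exact absurd hcω haω
      · simp
    obtain ⟨n, hn | hn⟩ := exists_zpow_of_mem_parabolic h1
    · exact hne (by simpa using hn)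
    · exact hcon b hb (by simpa using hn)
  have hletter : ∀ a ∈ ω, ∃ b ∈ ({i, k} : Set B), θ (cs.simple a) * x = x * cs.simple b := by
    intro a ha
    have hleft : ∀ j ∈ τ '' ({i, k} : Set B), ¬cs.IsLeftDescent x j := by
      rintro _ ⟨j, hj, rfl⟩
      exact mt (D.isLeftDescent_iff hθx j).mp (hnd j hj)
    rw [D.map_simple]
    refine cs.exists_simple_mul_eq_mul_simple (J' := τ '' {i, k}) (ω := ω.map τ) hnd hleft hleft
      ?_ ?_ hpJ ?_ _ (List.mem_map_of_mem ha)
    · intro b hb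
      obtain ⟨c, hc, rfl⟩ := List.mem_map.mp hb
      exact ⟨c, hω c hc, rfl⟩
    · rw [IsReduced, ← D.map_wordProd, D.length_map, hred.eq, List.length_map]
    · rw [← D.map_wordProd, hprod, hxp]
  obtain ⟨b, hb, hib⟩ := hletter i (hmem i (by simp) k (by simp) fun c hc ↦ hω c hc)
  obtain ⟨c, hc, hkc⟩ := hletter k (hmem k (by simp) i (by simp) fun c hc ↦ (hω c hc).symm)
  have hbc : b ≠ c := by
    rintro rfl
    exact hik (θ.injective (mul_right_cancel (hib.trans hkc.symm)))
  have hid : ∀ a ∈ ({i, k} : Set B), cs.IsLeftDescent w a →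
      ¬θ (cs.simple a) * x = x * cs.simple a := by
    intro a _ had hax
    exact D.conj_simple_ne hl had (by rw [hax]; simp)
  obtain ⟨a, ha, had⟩ := cs.exists_rightDescent_of_mem_parabolic (inv_mem hw)
    (inv_ne_one.mpr hw1)
  rw [isRightDescent_inv_iff] at had
  rcases hb with rfl | rfl <;> rcases hc with rfl | rfl
  · exact hbc rfl
  · rcases ha with rfl | rfl
    · exact hid _ (by simp) had hib
    · exact hid _ (by simp) had hkc
  · exact D.false_of_swap hNOF hx hik (hnd _ (by simp)) (hnd _ (by simp)) hib hkc hpJ hr hxp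
  · exact hbc rfl

theorem bruhat_conj_simple (D : cs.IsDiagramInvolution θ τ)
    (hNOF : ∀ i, θ (cs.simple i) ≠ cs.simple i →
      Even (orderOf (cs.simple i * θ (cs.simple i))) ∨
        orderOf (cs.simple i * θ (cs.simple i)) = 0)
    {u v : W} (hu : ∃ w, u = θ w⁻¹ * w) (hv : ∃ w, v = θ w⁻¹ * w) (huv : cs.Bruhat u v) {i : B}
    (hvi : θ (cs.simple i) * v * cs.simple i = v) (hui : θ (cs.simple i) * u * cs.simple i ≠ u)
    (hi : ¬cs.IsRightDescent u i) : cs.Bruhat (θ (cs.simple i) * u * cs.simple i) v := by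
  induction hn : cs.length v using Nat.strong_induction_on generalizing u v i with
  | _ n ih =>
    have hvd : ¬cs.IsRightDescent v i := by
      obtain ⟨w, rfl⟩ := hv
      exact D.not_isRightDescent w hvi
    have hne : u ≠ v := by
      rintro rfl
      exact hui hvi
    have hv1 : v ≠ 1 := by
      rintro rfl
      exact hne (huv.eq_of_length_le (by simp))
    obtain ⟨k, hk⟩ := cs.exists_rightDescent_of_ne_one hv1
    have hik : cs.simple i ≠ cs.simple k := by
      intro h
      rw [IsRightDescent, h] at hvd
      exact hvd hk
    obtain ⟨w, hw, x, hx, rfl, hvl, hxd, hxmax⟩ := D.exists_conj_parabolic hv {i, k}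
    have hw1 : w ≠ 1 := by
      rintro rfl
      exact hxd k (by simp) (by simpa using hk)
    have hwl : 0 < cs.length w := Nat.pos_of_ne_zero (mt cs.length_eq_zero_iff.mp hw1)
    obtain ⟨a, ha, hwa, hxa⟩ :=
      D.exists_simple_mul_eq_mul_simple hNOF hx hik hxd hw hw1 hvl hvi
    have hawd : ¬cs.IsLeftDescent w a := fun h ↦ D.conj_simple_ne hvl h hxa
    have hQ : ∀ j ∈ ({i, k} : Set B), cs.IsLeftDescent (cs.simple a * w) j := by
      have hal := cs.not_isLeftDescent_iff.mp hawd
      obtain ⟨b, hb, hbd⟩ := cs.exists_rightDescent_of_mem_parabolic (inv_mem hw)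
        (inv_ne_one.mpr hw1)
      rw [isRightDescent_inv_iff] at hbd
      have hqa : cs.IsLeftDescent (cs.simple a * w) a := by
        rw [IsLeftDescent, simple_mul_simple_cancel_left]
        omega
      have hqb : cs.IsLeftDescent (cs.simple a * w) b := by
        have h1 := cs.length_mul_le (cs.simple b * w) (cs.simple i)
        have h2 := cs.isLeftDescent_iff.mp hbd
        rw [length_simple] at h1
        rw [IsLeftDescent, hal, ← hwa, ← mul_assoc]
        omega
      have hab : a ≠ b := by
        rintro rfl
        exact hawd hbd
      rcases ha with rfl | rfl <;> rcases hb with rfl | rfl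
      · exact absurd rfl hab
      · rintro j (rfl | rfl) <;> assumption
      · rintro j (rfl | rfl) <;> assumption
      · exact absurd rfl hab
    have hle : ∀ G ∈ cs.parabolic {i, k}, ¬cs.IsLeftDescent G a → cs.Bruhat G w := by
      intro G hG hGa
      simpa using (Bruhat.of_mem_parabolic hQ hG).le_simple_mul hGa
    have hθu := D.map_eq_inv hu
    have hul := D.length_conj_of_ascent hθu hi hui
    obtain ⟨g, hg, y, hy, rfl, hgl, hyd, -⟩ := D.exists_conj_parabolic hu {i, k}
    have hθy := D.map_eq_inv hy
    have hyx : cs.Bruhat y x := by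
      refine hxmax y hθy hyd (Bruhat.trans ?_ huv)
      simpa using D.bruhat_conj (Bruhat.one_le g) (Bruhat.refl y) hgl
    have hu' : θ (cs.simple i) * (θ g⁻¹ * y * g) * cs.simple i =
        θ (g * cs.simple i)⁻¹ * y * (g * cs.simple i) := by
      simp [mul_assoc]
    have hGmem : g * cs.simple i ∈ cs.parabolic {i, k} :=
      mul_mem hg (cs.simple_mem_parabolic (by simp))
    have hGl : cs.length (θ (g * cs.simple i)⁻¹ * y * (g * cs.simple i)) =
        cs.length y + 2 * cs.length (g * cs.simple i) := by
      have h1 := D.length_conj_le y (g * cs.simple i)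
      have h2 := cs.length_mul_simple g i
      rw [← hu'] at h1 ⊢
      omega
    rw [hu']
    by_cases hGa : cs.IsLeftDescent (g * cs.simple i) a
    · have hya := D.conj_simple_ne hGl hGa
      have h1 := ih _ (by omega) hy hx hyx hxa hya (hyd a ha) rfl
      rw [D.conj_eq y _ a]
      refine D.bruhat_conj (hle _ (mul_mem (cs.simple_mem_parabolic ha) hGmem) ?_) h1 hvl
      rw [IsLeftDescent, simple_mul_simple_cancel_left]
      have := cs.isLeftDescent_iff.mp hGa
      omega
    · exact D.bruhat_conj (hle _ hGmem hGa) hyx hvl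

end IsDiagramInvolution

end CoxeterSystem

namespace TwistedIdentitiesPaper

open scoped Classical

variable {B : Type*} {W : Type*} [Group W] {M : CoxeterMatrix B}

theorem statement14 [Finite B] (cs : CoxeterSystem M W) (θ : W ≃* W)
    (hθ : Function.Involutive θ)
    (hθS : ∀ i : B, ∃ j : B, θ (cs.simple i) = cs.simple j)
    (hNOF : NOF cs θ)
    (u v : W) (hu : u ∈ twistedIdentities θ) (hv : v ∈ twistedIdentities θ)
    (huv : bruhatLT cs u v)
    (i : B) (hvs : θ (cs.simple i) * v * cs.simple i = v)
    (hus : θ (cs.simple i) * u * cs.simple i ≠ u)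
    (hlen : cs.length u < cs.length (twistAct cs θ u i)) :
    bruhatLT cs (twistAct cs θ u i) v := by
  choose τ hτ using hθS
  have D : cs.IsDiagramInvolution θ τ := ⟨hθ, hτ⟩
  have bruhat_of_le : ∀ {x y : W}, bruhatLE cs x y → cs.Bruhat x y := by
    intro x y h
    obtain ⟨ω, hω, rfl⟩ := cs.exists_isReduced y
    obtain ⟨ω', hsub, rfl⟩ := h ω hω rfl
    exact .of_sublist hsub hω
  have hact : twistAct cs θ u i = θ (cs.simple i) * u * cs.simple i := if_neg hus
  rw [hact] at hlen ⊢
  have hi : ¬cs.IsRightDescent u i := by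
    intro hi
    have := D.length_conj_of_descent (D.map_eq_inv hu) hi hus
    omega
  have h := D.bruhat_conj_simple hNOF hu hv (bruhat_of_le huv.1) hvs hus hi
  refine ⟨fun l _ hl ↦ h.exists_sublist l hl, ?_⟩
  rintro rfl
  refine hus ?_
  rw [← mul_left_cancel_iff (a := θ (cs.simple i)), ← mul_right_cancel_iff (a := cs.simple i)]
  simpa only [mul_assoc] using hvs

end TwistedIdentitiesPaper
end
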